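/- arXiv:1512.05940 — 3 statements merged into one kernel-verified Lean document; each statement's English description precedes it below -/
import Mathlib

section
/- Let N ∈ ℕ∖{0}, j ∈ {1,2}, and assume μ_j = 1 and ρ_j ≥ 2 (the other exponents satisfying ρ ≥ 1, μ ∈ (0,1]). Suppose ψ satisfies Assumption (P_{ρ1,ρ2,N}) and U satisfies Assumption (A_{μ1,μ2,N}). Then the expansion of Erdélyi's theorem (decomposition ∫_{p1}^{p2} U e^{iωψ} = Σ_{j=1,2}(A_N^{(j)}(ω)+R_N^{(j)}(ω)) with the same A_N^{(j)}, R_N^{(j)}) still holds, and for every γ ∈ (0,1), setting δ := (γ+N)/ρ_j ∈ (N/ρ_j, (N+1)/ρ_j), there is a constant L_{γ,ρ_j,N} > 0 (namely L_{γ,ρ_j,N} = a_{N,ρ_j} K^γ with K the unique positive root of a_{N,ρ_j}K^{ρ_j} − b_{N,ρ_j}K − c_{N,ρ_j} = 0, a, b, c being the constants from the two estimates of φ_N^{(j)}(·,·,ρ_j,1)) such that for all ω > 0, |R_N^{(j)}(ω)| ≤ L_{γ,ρ_j,N} (∫_0^{s_j} s^{−γ} |(ν_j k_j)^{(N)}(s)|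 ds) ω^{−δ}. -/
open MeasureTheory Set

/-- Direction of the ray `Λ^{(j)}(s)`: `e^{(−1)^{j+1} iπ/(2ρ)}`, encoded by the sign `σ`. -/
noncomputable def edir (σ ρ : ℝ) : ℂ := Complex.exp (Complex.I * ((σ * Real.pi / (2 * ρ) : ℝ) : ℂ))

/-- `φ_N^{(j)}(s,ω,ρ,μ)`, the ray `Λ^{(j)}(s)` being parametrized by `t ↦ s + t·edir σ ρ`. -/
noncomputable def phiN (σ ρ μ : ℝ) (N : ℕ) (s ω : ℝ) : ℂ :=
  ((-1 : ℂ) ^ N / (Nat.factorial (N - 1) : ℂ)) *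
    ∫ t in Set.Ioi (0 : ℝ),
      ((t : ℂ) * edir σ ρ) ^ (N - 1) *
        (((s : ℂ) + (t : ℂ) * edir σ ρ) ^ ((μ - 1 : ℝ) : ℂ)) *
        Complex.exp ((σ : ℂ) * Complex.I * (ω : ℂ) * (((s : ℂ) + (t : ℂ) * edir σ ρ) ^ ((ρ : ℝ) : ℂ))) *
        edir σ ρ

/-- `Θ_{n+1}^{(j)}(ρ,μ)` with `σ = (−1)^{j+1}`. -/
noncomputable def theta (σ ρ μ : ℝ) (n : ℕ) : ℂ :=
  ((σ : ℂ) / ((Nat.factorial n : ℂ) * (ρ : ℂ))) *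
    ((Real.Gamma (((n : ℝ) + μ) / ρ) : ℝ) : ℂ) *
    Complex.exp ((σ : ℂ) * Complex.I * ((Real.pi / 2 * (((n : ℝ) + μ) / ρ) : ℝ) : ℂ))

/-- The point `s + t·edir σ ρ` of the ray issued from `s`. -/
noncomputable def rayPt (σ ρ s t : ℝ) : ℂ := (s : ℂ) + (t : ℂ) * edir σ ρ

/-- The function `z ↦ z^α e^{σ i ω z^ρ}`. -/
noncomputable def oscPow (σ ω ρ α : ℝ) (z : ℂ) : ℂ :=
  z ^ (α : ℂ) * Complex.exp ((σ : ℂ) * Complex.I * (ω : ℂ) * z ^ (ρ : ℂ))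

/-- The integral of `(z - s)^n z^α e^{σ i ω z^ρ}` along the ray issued from `s`. -/
noncomputable def rayMoment (σ ω ρ : ℝ) (n : ℕ) (α s : ℝ) : ℂ :=
  ∫ t in Ioi (0 : ℝ),
    ((t : ℂ) * edir σ ρ) ^ n * oscPow σ ω ρ α (rayPt σ ρ s t) * edir σ ρ

lemma phiN_succ_eq (σ ρ μ : ℝ) (n : ℕ) (s ω : ℝ) :
    phiN σ ρ μ (n + 1) s ω =
      ((-1 : ℂ) ^ (n + 1) / (n.factorial : ℂ)) * rayMoment σ ω ρ n (μ - 1) s := by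
  simp only [phiN, rayMoment, oscPow, rayPt, Nat.add_sub_cancel, mul_assoc]

lemma edir_eq (σ ρ : ℝ) :
    edir σ ρ = Complex.exp (((σ * (Real.pi / (2 * ρ)) : ℝ) : ℂ) * Complex.I) := by
  rw [edir, mul_comm, mul_div_assoc]

lemma norm_edir (σ ρ : ℝ) : ‖edir σ ρ‖ = 1 := by
  rw [edir_eq, Complex.norm_exp_ofReal_mul_I]

lemma edir_ne_zero (σ ρ : ℝ) : edir σ ρ ≠ 0 := by
  rw [edir]; exact Complex.exp_ne_zero _

lemma edir_neg (ρ : ℝ) : edir (-1) ρ = (starRingEnd ℂ) (edir 1 ρ) := by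
  rw [edir_eq, edir_eq, ← Complex.exp_conj]
  congr 1
  rw [map_mul, Complex.conj_ofReal, Complex.conj_I]
  push_cast
  ring

lemma edir_one_re (ρ : ℝ) : (edir 1 ρ).re = Real.cos (Real.pi / (2 * ρ)) := by
  rw [edir_eq, Complex.exp_ofReal_mul_I_re, one_mul]

lemma edir_one_im (ρ : ℝ) : (edir 1 ρ).im = Real.sin (Real.pi / (2 * ρ)) := by
  rw [edir_eq, Complex.exp_ofReal_mul_I_im, one_mul]

lemma angle_mem {ρ : ℝ} (hρ : 1 ≤ ρ) : Real.pi / (2 * ρ) ∈ Ioc 0 (Real.pi / 2) := by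
  have hpi := Real.pi_pos
  refine ⟨by positivity, ?_⟩
  apply div_le_div_of_nonneg_left hpi.le (by norm_num) (by linarith)

lemma edir_one_re_nonneg {ρ : ℝ} (hρ : 1 ≤ ρ) : 0 ≤ (edir 1 ρ).re := by
  rw [edir_one_re]
  have h := angle_mem hρ
  exact Real.cos_nonneg_of_mem_Icc ⟨by linarith [h.1, Real.pi_pos], h.2⟩

lemma edir_one_im_pos {ρ : ℝ} (hρ : 1 ≤ ρ) : 0 < (edir 1 ρ).im := by
  rw [edir_one_im]
  have h := angle_mem hρ
  exact Real.sin_pos_of_mem_Ioo ⟨h.1, by linarith [h.2, Real.pi_pos]⟩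

lemma edir_re_nonneg {σ ρ : ℝ} (hσ : σ = 1 ∨ σ = -1) (hρ : 1 ≤ ρ) : 0 ≤ (edir σ ρ).re := by
  rcases hσ with rfl | rfl
  · exact edir_one_re_nonneg hρ
  · rw [edir_neg, Complex.conj_re]; exact edir_one_re_nonneg hρ

lemma edir_im_ne_zero {σ ρ : ℝ} (hσ : σ = 1 ∨ σ = -1) (hρ : 1 ≤ ρ) : (edir σ ρ).im ≠ 0 := by
  rcases hσ with rfl | rfl
  · exact (edir_one_im_pos hρ).ne'
  · rw [edir_neg, Complex.conj_im]; exact (neg_neg_of_pos (edir_one_im_pos hρ)).ne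

lemma rayPt_re (σ ρ s t : ℝ) : (rayPt σ ρ s t).re = s + t * (edir σ ρ).re := by
  simp [rayPt]

lemma rayPt_im (σ ρ s t : ℝ) : (rayPt σ ρ s t).im = t * (edir σ ρ).im := by
  simp [rayPt]

lemma rayPt_neg (ρ s t : ℝ) : rayPt (-1) ρ s t = (starRingEnd ℂ) (rayPt 1 ρ s t) := by
  simp [rayPt, edir_neg]

lemma rayPt_mem_slitPlane {σ ρ s t : ℝ} (hσ : σ = 1 ∨ σ = -1) (hρ : 1 ≤ ρ) (ht : 0 ≤ t)
    (hst : 0 < s ∨ 0 < t) : rayPt σ ρ s t ∈ Complex.slitPlane := by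
  rw [Complex.mem_slitPlane_iff, rayPt_re, rayPt_im]
  have h := edir_re_nonneg hσ hρ
  rcases hst with h' | h'
  · left; positivity
  · right; exact mul_ne_zero h'.ne' (edir_im_ne_zero hσ hρ)

lemma norm_rayPt_sq (σ ρ s t : ℝ) :
    ‖rayPt σ ρ s t‖ ^ 2 = s ^ 2 + t ^ 2 + 2 * (s * t * (edir σ ρ).re) := by
  have h1 := norm_edir σ ρ
  have h2 : (edir σ ρ).re ^ 2 + (edir σ ρ).im ^ 2 = 1 := by
    have := Complex.sq_norm (edir σ ρ)
    rw [h1, Complex.normSq_apply] at this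
    linarith
  rw [Complex.sq_norm, Complex.normSq_apply, rayPt_re, rayPt_im]
  linear_combination t ^ 2 * h2

lemma le_norm_rayPt_left {σ ρ s t : ℝ} (hσ : σ = 1 ∨ σ = -1) (hρ : 1 ≤ ρ) (hs : 0 ≤ s)
    (ht : 0 ≤ t) : s ≤ ‖rayPt σ ρ s t‖ := by
  refine (pow_le_pow_iff_left₀ hs (norm_nonneg _) two_ne_zero).1 ?_
  rw [norm_rayPt_sq]
  have := mul_nonneg (mul_nonneg hs ht) (edir_re_nonneg hσ hρ)
  nlinarith [sq_nonneg t]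

lemma le_norm_rayPt_right {σ ρ s t : ℝ} (hσ : σ = 1 ∨ σ = -1) (hρ : 1 ≤ ρ) (hs : 0 ≤ s)
    (ht : 0 ≤ t) : t ≤ ‖rayPt σ ρ s t‖ := by
  refine (pow_le_pow_iff_left₀ ht (norm_nonneg _) two_ne_zero).1 ?_
  rw [norm_rayPt_sq]
  have := mul_nonneg (mul_nonneg hs ht) (edir_re_nonneg hσ hρ)
  nlinarith [sq_nonneg s]

lemma norm_rayPt_le {σ ρ s t : ℝ} (hs : 0 ≤ s) (ht : 0 ≤ t) :
    ‖rayPt σ ρ s t‖ ≤ s + t := by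
  refine (norm_add_le _ _).trans ?_
  rw [norm_mul, norm_edir, Complex.norm_of_nonneg hs, Complex.norm_of_nonneg ht, mul_one]

lemma arg_rayPt_mem {ρ s t : ℝ} (hρ : 1 ≤ ρ) (hs : 0 ≤ s) (ht : 0 < t) :
    (rayPt 1 ρ s t).arg ∈ Icc 0 (Real.pi / (2 * ρ)) := by
  have him := edir_one_im_pos hρ
  have hre := edir_one_re_nonneg hρ
  have h0 : 0 ≤ (rayPt 1 ρ s t).arg := by
    rw [Complex.arg_nonneg_iff, rayPt_im]; positivity
  have h1 : (rayPt 1 ρ s t).arg ≤ Real.pi / 2 := by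
    have := (Complex.abs_arg_le_pi_div_two_iff (z := rayPt 1 ρ s t)).2
      (by rw [rayPt_re]; positivity)
    exact (abs_le.1 this).2
  refine ⟨h0, ?_⟩
  by_contra! hlt
  have hβ := angle_mem hρ
  have hz : 0 < ‖rayPt 1 ρ s t‖ :=
    ht.trans_le (le_norm_rayPt_right (Or.inl rfl) hρ hs ht.le)
  have hsin : 0 < Real.sin ((rayPt 1 ρ s t).arg - Real.pi / (2 * ρ)) :=
    Real.sin_pos_of_mem_Ioo ⟨by linarith, by linarith [hβ.1, Real.pi_pos]⟩
  have e1 := Complex.norm_mul_cos_arg (rayPt 1 ρ s t)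
  have e2 := Complex.norm_mul_sin_arg (rayPt 1 ρ s t)
  rw [rayPt_re, edir_one_re] at e1
  rw [rayPt_im, edir_one_im] at e2
  rw [edir_one_im] at him
  rw [Real.sin_sub] at hsin
  have h3 := mul_pos hz hsin
  have h4 : ‖rayPt 1 ρ s t‖ * (Real.sin (rayPt 1 ρ s t).arg * Real.cos (Real.pi / (2 * ρ)) -
      Real.cos (rayPt 1 ρ s t).arg * Real.sin (Real.pi / (2 * ρ))) =
      - (s * Real.sin (Real.pi / (2 * ρ))) := by
    linear_combination Real.cos (Real.pi / (2 * ρ)) * e2 - Real.sin (Real.pi / (2 * ρ)) * e1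
  rw [h4] at h3
  have := mul_nonneg hs him.le
  linarith

lemma mul_edir_cpow {σ ρ t : ℝ} (hσ : σ = 1 ∨ σ = -1) (hρ : 1 ≤ ρ) (ht : 0 < t) (α : ℝ) :
    ((t : ℂ) * edir σ ρ) ^ (α : ℂ) =
      ((t ^ α : ℝ) : ℂ) * Complex.exp (((σ * (Real.pi / (2 * ρ)) * α : ℝ) : ℂ) * Complex.I) := by
  have hβ := angle_mem hρ
  have hpi := Real.pi_pos
  have hlog : Complex.log (edir σ ρ) = ((σ * (Real.pi / (2 * ρ)) : ℝ) : ℂ) * Complex.I := by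
    have hσ' : |σ| = 1 := by rcases hσ with rfl | rfl <;> norm_num
    have habs : |σ * (Real.pi / (2 * ρ))| ≤ Real.pi / 2 := by
      rw [abs_mul, hσ', one_mul, abs_of_pos hβ.1]; exact hβ.2
    rw [abs_le] at habs
    rw [edir_eq, Complex.log_exp] <;> rw [Complex.im_ofReal_mul, Complex.I_im, mul_one] <;>
      linarith
  rw [Complex.cpow_def_of_ne_zero (mul_ne_zero (by exact_mod_cast ht.ne') (edir_ne_zero _ _)),
    Complex.log_ofReal_mul ht (edir_ne_zero _ _), hlog, Real.rpow_def_of_pos ht,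
    Complex.ofReal_exp, ← Complex.exp_add]
  congr 1
  push_cast
  ring

lemma im_cpow_rayPt_one {ρ s t : ℝ} (hρ : 1 ≤ ρ) (hs : 0 ≤ s) (ht : 0 < t) :
    t ^ ρ ≤ ((rayPt 1 ρ s t) ^ (ρ : ℂ)).im := by
  have hd : ∀ x : ℝ, 0 ≤ x → HasDerivAt (fun x : ℝ => ((rayPt 1 ρ x t) ^ (ρ : ℂ)).im)
      ((ρ : ℂ) * (rayPt 1 ρ x t) ^ ((ρ : ℂ) - 1)).im x := by
    intro x hx
    have h1 : HasDerivAt (fun x : ℝ => rayPt 1 ρ x t) 1 x := by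
      unfold rayPt
      exact (Complex.ofRealCLM.hasDerivAt (x := x)).add_const _
    have h2 := (hasDerivAt_id (rayPt 1 ρ x t)).cpow_const (c := (ρ : ℂ))
      (rayPt_mem_slitPlane (Or.inl rfl) hρ ht.le (Or.inr ht))
    have h3 := HasDerivAt.scomp x h2 h1
    have h4 := (Complex.imCLM.hasFDerivAt.comp_hasDerivAt x h3)
    have h5 : ((ρ : ℂ) * (rayPt 1 ρ x t) ^ ((ρ : ℂ) - 1)).im =
        Complex.imCLM ((1 : ℝ) • ((ρ : ℂ) * id (rayPt 1 ρ x t) ^ ((ρ : ℂ) - 1) * 1)) := by simp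
    rw [h5]
    exact h4
  have hmono : MonotoneOn (fun x : ℝ => ((rayPt 1 ρ x t) ^ (ρ : ℂ)).im) (Ici 0) := by
    apply monotoneOn_of_deriv_nonneg (convex_Ici 0)
    · exact fun x hx => (hd x hx).continuousAt.continuousWithinAt
    · intro x hx
      rw [interior_Ici] at hx
      exact (hd x hx.le).differentiableAt.differentiableWithinAt
    · intro x hx
      rw [interior_Ici] at hx
      rw [(hd x hx.le).deriv, Complex.im_ofReal_mul]
      refine mul_nonneg (by linarith) ?_
      have : ((ρ : ℂ) - 1) = ((ρ - 1 : ℝ) : ℂ) := by push_cast; ring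
      rw [this, Complex.cpow_ofReal_im]
      have ha := arg_rayPt_mem hρ hx.le ht
      refine mul_nonneg (by positivity) (Real.sin_nonneg_of_nonneg_of_le_pi
        (mul_nonneg ha.1 (by linarith)) ?_)
      calc (rayPt 1 ρ x t).arg * (ρ - 1) ≤ Real.pi / (2 * ρ) * ρ :=
            mul_le_mul ha.2 (by linarith) (by linarith) (angle_mem hρ).1.le
        _ = Real.pi / 2 := by field_simp
        _ ≤ Real.pi := by linarith [Real.pi_pos]
  have h0 := hmono (mem_Ici.2 le_rfl) (mem_Ici.2 hs) hs
  refine le_trans (le_of_eq ?_) h0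
  simp only [rayPt, Complex.ofReal_zero, zero_add]
  rw [mul_edir_cpow (Or.inl rfl) hρ ht, Complex.im_ofReal_mul, Complex.exp_ofReal_mul_I_im]
  have : (1 * (Real.pi / (2 * ρ)) * ρ) = Real.pi / 2 := by field_simp
  rw [this, Real.sin_pi_div_two, mul_one]

lemma im_cpow_rayPt {σ ρ s t : ℝ} (hσ : σ = 1 ∨ σ = -1) (hρ : 1 ≤ ρ) (hs : 0 ≤ s) (ht : 0 < t) :
    t ^ ρ ≤ σ * ((rayPt σ ρ s t) ^ (ρ : ℂ)).im := by
  have h := im_cpow_rayPt_one hρ hs ht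
  rcases hσ with rfl | rfl
  · rwa [one_mul]
  · rw [rayPt_neg, Complex.conj_cpow, Complex.conj_ofReal, Complex.conj_im]
    · linarith
    · exact Complex.slitPlane_arg_ne_pi
        (rayPt_mem_slitPlane (Or.inl rfl) hρ ht.le (Or.inr ht))

lemma norm_oscPow_rayPt_le {σ ω ρ s t : ℝ} (hσ : σ = 1 ∨ σ = -1) (hω : 0 < ω) (hρ : 1 ≤ ρ)
    (hs : 0 ≤ s) (ht : 0 < t) (α : ℝ) :
    ‖oscPow σ ω ρ α (rayPt σ ρ s t)‖ ≤ ‖rayPt σ ρ s t‖ ^ α * Real.exp (-ω * t ^ ρ) := by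
  have hz : rayPt σ ρ s t ≠ 0 :=
    Complex.slitPlane_ne_zero (rayPt_mem_slitPlane hσ hρ ht.le (Or.inr ht))
  rw [oscPow, norm_mul, Complex.norm_cpow_of_ne_zero hz, Complex.norm_exp]
  simp only [Complex.ofReal_im, mul_zero, Real.exp_zero, div_one, Complex.ofReal_re]
  gcongr
  have h := mul_le_mul_of_nonneg_left (im_cpow_rayPt hσ hρ hs ht) hω.le
  have : ((σ : ℂ) * Complex.I * (ω : ℂ) * (rayPt σ ρ s t) ^ (ρ : ℂ)).re =
      - (ω * (σ * ((rayPt σ ρ s t) ^ (ρ : ℂ)).im)) := by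
    simp [Complex.mul_re, Complex.mul_im]
    ring
  rw [this]
  linarith

lemma integrableOn_pow_mul_exp {ω ρ : ℝ} (hω : 0 < ω) (hρ : 1 ≤ ρ) (n : ℕ) :
    IntegrableOn (fun t : ℝ => t ^ n * Real.exp (-ω * t ^ ρ)) (Ioi 0) := by
  have h := integrableOn_rpow_mul_exp_neg_mul_rpow (p := ρ) (s := n) (b := ω)
    (by have : (0 : ℝ) ≤ n := n.cast_nonneg
        linarith) (by linarith) hω
  simpa only [Real.rpow_natCast] using h

lemma exists_rpow_le_mul_one_add_pow {m : ℝ} (hm : 0 < m) (M κ : ℝ) :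
    ∃ C : ℝ, ∃ q : ℕ, ∀ t : ℝ, 0 ≤ t → ∀ x : ℝ, m ≤ x → x ≤ M + t →
      x ^ κ ≤ C * (1 + t ^ q) := by
  obtain ⟨q, hq⟩ := exists_nat_ge |κ|
  refine ⟨2 ^ (q - 1) * (1 / m + |M| + 1) ^ q, q, fun t ht x hx1 hx2 => ?_⟩
  have hx : 0 < x := hm.trans_le hx1
  set B : ℝ := 1 / m + |M| + 1 with hB
  have hm' : 0 < 1 / m := by positivity
  have hM := abs_nonneg M
  have hB1 : 1 ≤ B := by linarith
  have hxB : x ≤ B + t := by linarith [le_abs_self M]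
  have hxB' : x⁻¹ ≤ B + t := by
    have : x⁻¹ ≤ 1 / m := by rw [one_div]; exact inv_anti₀ hm hx1
    linarith
  have h1 : x ^ κ ≤ (B + t) ^ |κ| := by
    rcases le_total 0 κ with hκ | hκ
    · rw [abs_of_nonneg hκ]; exact Real.rpow_le_rpow hx.le hxB hκ
    · have hinv : x ^ κ = x⁻¹ ^ (-κ) := by
        rw [Real.inv_rpow hx.le, Real.rpow_neg hx.le, inv_inv]
      rw [abs_of_nonpos hκ, hinv]
      exact Real.rpow_le_rpow (by positivity) hxB' (by linarith)
  calc x ^ κ ≤ (B + t) ^ |κ| := h1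
    _ ≤ (B + t) ^ (q : ℝ) := Real.rpow_le_rpow_of_exponent_le (by linarith) hq
    _ = (B + t) ^ q := Real.rpow_natCast _ _
    _ ≤ (B * (1 + t)) ^ q := by
        gcongr
        nlinarith
    _ = B ^ q * (1 + t) ^ q := mul_pow _ _ _
    _ ≤ B ^ q * (2 ^ (q - 1) * (1 ^ q + t ^ q)) := by
        gcongr
        exact add_pow_le zero_le_one ht q
    _ = 2 ^ (q - 1) * B ^ q * (1 + t ^ q) := by rw [one_pow]; ring

lemma norm_ray_integrand_le {σ ω ρ s t : ℝ} (hσ : σ = 1 ∨ σ = -1) (hω : 0 < ω) (hρ : 1 ≤ ρ)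
    (hs : 0 ≤ s) (ht : 0 < t) (n : ℕ) (α : ℝ) :
    ‖((t : ℂ) * edir σ ρ) ^ n * oscPow σ ω ρ α (rayPt σ ρ s t) * edir σ ρ‖ ≤
      t ^ n * (‖rayPt σ ρ s t‖ ^ α * Real.exp (-ω * t ^ ρ)) := by
  rw [norm_mul, norm_mul, norm_pow, norm_mul, norm_edir, mul_one, mul_one,
    Complex.norm_of_nonneg ht.le]
  gcongr
  exact norm_oscPow_rayPt_le hσ hω hρ hs ht α

lemma exists_ray_bound {σ ω ρ m : ℝ} (hσ : σ = 1 ∨ σ = -1) (hω : 0 < ω) (hρ : 1 ≤ ρ)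
    (hm : 0 < m) (M : ℝ) (n : ℕ) (α : ℝ) :
    ∃ bound : ℝ → ℝ, IntegrableOn bound (Ioi 0) ∧ ∀ s ∈ Icc m M, ∀ t ∈ Ioi (0 : ℝ),
      ‖((t : ℂ) * edir σ ρ) ^ n * oscPow σ ω ρ α (rayPt σ ρ s t) * edir σ ρ‖ ≤ bound t := by
  obtain ⟨C, q, hC⟩ := exists_rpow_le_mul_one_add_pow hm M α
  refine ⟨fun t => C * (t ^ n * Real.exp (-ω * t ^ ρ)) +
    C * (t ^ (n + q) * Real.exp (-ω * t ^ ρ)), ?_, fun s hs t ht => ?_⟩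
  · exact ((integrableOn_pow_mul_exp hω hρ n).const_mul C).add
      ((integrableOn_pow_mul_exp hω hρ (n + q)).const_mul C)
  · have ht' : 0 < t := ht
    have hs0 : 0 ≤ s := hm.le.trans hs.1
    refine (norm_ray_integrand_le hσ hω hρ hs0 ht n α).trans ?_
    calc t ^ n * (‖rayPt σ ρ s t‖ ^ α * Real.exp (-ω * t ^ ρ))
        ≤ t ^ n * ((C * (1 + t ^ q)) * Real.exp (-ω * t ^ ρ)) := by
          gcongr
          exact hC t ht'.le _ (hs.1.trans (le_norm_rayPt_left hσ hρ hs0 ht'.le))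
            ((norm_rayPt_le hs0 ht'.le).trans (by linarith [hs.2]))
      _ = _ := by ring

lemma hasDerivAt_oscPow (σ ω ρ α : ℝ) {z : ℂ} (hz : z ∈ Complex.slitPlane) :
    HasDerivAt (oscPow σ ω ρ α)
      ((α : ℂ) * oscPow σ ω ρ (α - 1) z +
        (σ : ℂ) * Complex.I * (ω : ℂ) * (ρ : ℂ) * oscPow σ ω ρ (α + ρ - 1) z) z := by
  have hz0 := Complex.slitPlane_ne_zero hz
  have h1 := (hasDerivAt_id z).cpow_const (c := (α : ℂ)) hz
  have h2 := ((hasDerivAt_id z).cpow_const (c := (ρ : ℂ)) hz).const_mul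
    ((σ : ℂ) * Complex.I * (ω : ℂ))
  have h3 := h1.mul h2.cexp
  refine h3.congr_deriv ?_
  simp only [oscPow, id]
  have e1 : z ^ ((α - 1 : ℝ) : ℂ) = z ^ ((α : ℂ) - 1) := by push_cast; rfl
  have e2 : z ^ ((α + ρ - 1 : ℝ) : ℂ) = z ^ (α : ℂ) * z ^ ((ρ : ℂ) - 1) := by
    rw [← Complex.cpow_add _ _ hz0]; push_cast; ring_nf
  rw [e1, e2]
  ring

lemma hasDerivAt_rayPt_left (σ ρ s t : ℝ) : HasDerivAt (fun s : ℝ => rayPt σ ρ s t) 1 s :=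
  (Complex.ofRealCLM.hasDerivAt (x := s)).add_const _

lemma hasDerivAt_rayPt_right (σ ρ s t : ℝ) :
    HasDerivAt (fun t : ℝ => rayPt σ ρ s t) (edir σ ρ) t := by
  have h := ((Complex.ofRealCLM.hasDerivAt (x := t)).mul_const (edir σ ρ)).const_add (s : ℂ)
  refine h.congr_deriv ?_
  simp

lemma continuousAt_ray_integrand {σ ω ρ s t : ℝ} (hσ : σ = 1 ∨ σ = -1) (hρ : 1 ≤ ρ)
    (ht : 0 ≤ t) (hst : 0 < s ∨ 0 < t) (n : ℕ) (α : ℝ) :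
    ContinuousAt (fun t : ℝ =>
      ((t : ℂ) * edir σ ρ) ^ n * oscPow σ ω ρ α (rayPt σ ρ s t) * edir σ ρ) t := by
  have h1 : ContinuousAt (fun t : ℝ => oscPow σ ω ρ α (rayPt σ ρ s t)) t :=
    ContinuousAt.comp (g := oscPow σ ω ρ α)
      (hasDerivAt_oscPow σ ω ρ α (rayPt_mem_slitPlane hσ hρ ht hst)).continuousAt
      (hasDerivAt_rayPt_right σ ρ s t).continuousAt
  have h2 : ContinuousAt (fun t : ℝ => ((t : ℂ) * edir σ ρ) ^ n) t := by fun_prop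
  exact (h2.mul h1).mul continuousAt_const

lemma aestronglyMeasurable_ray_integrand {σ ω ρ s : ℝ} (hσ : σ = 1 ∨ σ = -1) (hρ : 1 ≤ ρ)
    (n : ℕ) (α : ℝ) :
    AEStronglyMeasurable (fun t : ℝ =>
      ((t : ℂ) * edir σ ρ) ^ n * oscPow σ ω ρ α (rayPt σ ρ s t) * edir σ ρ)
      (volume.restrict (Ioi 0)) :=
  ContinuousOn.aestronglyMeasurable (fun _ ht =>
    (continuousAt_ray_integrand hσ hρ (le_of_lt ht) (Or.inr ht) n α).continuousWithinAt)
    measurableSet_Ioi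

lemma integrableOn_ray_integrand {σ ω ρ s : ℝ} (hσ : σ = 1 ∨ σ = -1) (hω : 0 < ω) (hρ : 1 ≤ ρ)
    (hs : 0 < s) (n : ℕ) (α : ℝ) :
    IntegrableOn (fun t : ℝ =>
      ((t : ℂ) * edir σ ρ) ^ n * oscPow σ ω ρ α (rayPt σ ρ s t) * edir σ ρ) (Ioi 0) := by
  obtain ⟨bound, hb, hle⟩ := exists_ray_bound hσ hω hρ hs s n α
  refine Integrable.mono' hb (aestronglyMeasurable_ray_integrand hσ hρ n α) ?_
  filter_upwards [ae_restrict_mem measurableSet_Ioi] with t ht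
  exact hle s ⟨le_rfl, le_rfl⟩ t ht

/-- Integration by parts along a ray. -/
lemma rayMoment_by_parts {σ ω ρ s : ℝ} (hσ : σ = 1 ∨ σ = -1) (hω : 0 < ω) (hρ : 1 ≤ ρ)
    (hs : 0 < s) (n : ℕ) (α : ℝ) :
    (n : ℂ) * rayMoment σ ω ρ (n - 1) α s + ((α : ℂ) * rayMoment σ ω ρ n (α - 1) s +
      (σ : ℂ) * Complex.I * (ω : ℂ) * (ρ : ℂ) * rayMoment σ ω ρ n (α + ρ - 1) s) =
      - ((0 : ℂ) ^ n * oscPow σ ω ρ α s) := by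
  have hu : ∀ t : ℝ, 0 ≤ t → HasDerivAt
      (fun t : ℝ => ((t : ℂ) * edir σ ρ) ^ n * oscPow σ ω ρ α (rayPt σ ρ s t))
      ((n : ℂ) * (((t : ℂ) * edir σ ρ) ^ (n - 1) * oscPow σ ω ρ α (rayPt σ ρ s t) * edir σ ρ) +
        ((α : ℂ) * (((t : ℂ) * edir σ ρ) ^ n * oscPow σ ω ρ (α - 1) (rayPt σ ρ s t) * edir σ ρ) +
        (σ : ℂ) * Complex.I * (ω : ℂ) * (ρ : ℂ) *
          (((t : ℂ) * edir σ ρ) ^ n * oscPow σ ω ρ (α + ρ - 1) (rayPt σ ρ s t) * edir σ ρ))) t := by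
    intro t ht
    have h1 : HasDerivAt (fun t : ℝ => ((t : ℂ) * edir σ ρ) ^ n)
        ((n : ℂ) * ((t : ℂ) * edir σ ρ) ^ (n - 1) * edir σ ρ) t := by
      have := ((Complex.ofRealCLM.hasDerivAt (x := t)).mul_const (edir σ ρ)).pow n
      refine this.congr_deriv ?_
      simp
    have h2 := HasDerivAt.comp_of_eq t (hasDerivAt_oscPow σ ω ρ α
      (rayPt_mem_slitPlane hσ hρ ht (Or.inl hs))) (hasDerivAt_rayPt_right σ ρ s t) rfl
    refine (h1.mul h2).congr_deriv ?_
    simp only [Function.comp]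
    ring
  have hi1 := (integrableOn_ray_integrand hσ hω hρ hs (n - 1) α).const_mul (n : ℂ)
  have hi2 := (integrableOn_ray_integrand hσ hω hρ hs n (α - 1)).const_mul (α : ℂ)
  have hi3 := (integrableOn_ray_integrand hσ hω hρ hs n (α + ρ - 1)).const_mul
    ((σ : ℂ) * Complex.I * (ω : ℂ) * (ρ : ℂ))
  have hi := hi1.add (hi2.add hi3)
  have hi0 : IntegrableOn (fun t : ℝ => ((t : ℂ) * edir σ ρ) ^ n * oscPow σ ω ρ α (rayPt σ ρ s t))
      (Ioi 0) := by
    refine ((integrableOn_ray_integrand hσ hω hρ hs n α).mul_const (edir σ ρ)⁻¹).congr ?_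
    filter_upwards with t
    rw [mul_assoc _ _ (edir σ ρ)⁻¹, mul_inv_cancel₀ (edir_ne_zero σ ρ), mul_one]
  have htend := tendsto_zero_of_hasDerivAt_of_integrableOn_Ioi
    (fun t ht => hu t (le_of_lt ht)) hi hi0
  have h_int := integral_Ioi_of_hasDerivAt_of_tendsto
    (hu 0 le_rfl).continuousAt.continuousWithinAt (fun t ht => hu t (le_of_lt ht)) hi htend
  have h0 : rayPt σ ρ s 0 = (s : ℂ) := by simp [rayPt]
  rw [h0, Complex.ofReal_zero, zero_mul, zero_sub] at h_int
  rw [← h_int]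
  refine Eq.trans ?_ (integral_add hi1 (hi2.add hi3)).symm
  rw [integral_const_mul]
  congr 1
  refine Eq.trans ?_ (integral_add hi2 hi3).symm
  rw [integral_const_mul, integral_const_mul]
  rfl

lemma hasDerivAt_rayMoment {σ ω ρ s : ℝ} (hσ : σ = 1 ∨ σ = -1) (hω : 0 < ω) (hρ : 1 ≤ ρ)
    (hs : 0 < s) (n : ℕ) (α : ℝ) :
    HasDerivAt (rayMoment σ ω ρ n α)
      (-((n : ℂ) * rayMoment σ ω ρ (n - 1) α s) - (0 : ℂ) ^ n * oscPow σ ω ρ α s) s := by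
  obtain ⟨b1, hb1, hle1⟩ := exists_ray_bound hσ hω hρ (half_pos hs) (2 * s) n (α - 1)
  obtain ⟨b2, hb2, hle2⟩ := exists_ray_bound hσ hω hρ (half_pos hs) (2 * s) n (α + ρ - 1)
  have hi2 := (integrableOn_ray_integrand hσ hω hρ hs n (α - 1)).const_mul (α : ℂ)
  have hi3 := (integrableOn_ray_integrand hσ hω hρ hs n (α + ρ - 1)).const_mul
    ((σ : ℂ) * Complex.I * (ω : ℂ) * (ρ : ℂ))
  have key := (hasDerivAt_integral_of_dominated_loc_of_deriv_le
    (μ := volume.restrict (Ioi (0 : ℝ))) (x₀ := s) (s := Icc (s / 2) (2 * s))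
    (F := fun (s t : ℝ) => ((t : ℂ) * edir σ ρ) ^ n * oscPow σ ω ρ α (rayPt σ ρ s t) * edir σ ρ)
    (F' := fun (s t : ℝ) =>
      ((α : ℂ) * (((t : ℂ) * edir σ ρ) ^ n * oscPow σ ω ρ (α - 1) (rayPt σ ρ s t) * edir σ ρ) +
        (σ : ℂ) * Complex.I * (ω : ℂ) * (ρ : ℂ) *
          (((t : ℂ) * edir σ ρ) ^ n * oscPow σ ω ρ (α + ρ - 1) (rayPt σ ρ s t) * edir σ ρ)))
    (bound := fun t => ‖(α : ℂ)‖ * b1 t + ‖(σ : ℂ) * Complex.I * (ω : ℂ) * (ρ : ℂ)‖ * b2 t)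
    (Icc_mem_nhds (by linarith) (by linarith))
    (Filter.Eventually.of_forall fun x => aestronglyMeasurable_ray_integrand hσ hρ n α)
    (integrableOn_ray_integrand hσ hω hρ hs n α)
    (hi2.add hi3).aestronglyMeasurable ?_ ((hb1.const_mul _).add (hb2.const_mul _)) ?_).2
  · refine key.congr_deriv ?_
    have hbp := rayMoment_by_parts hσ hω hρ hs n α
    rw [integral_add hi2 hi3, integral_const_mul, integral_const_mul]
    change (α : ℂ) * rayMoment σ ω ρ n (α - 1) s +
      (σ : ℂ) * Complex.I * (ω : ℂ) * (ρ : ℂ) * rayMoment σ ω ρ n (α + ρ - 1) s = _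
    linear_combination hbp
  · filter_upwards [ae_restrict_mem measurableSet_Ioi] with t ht x hx
    refine (norm_add_le _ _).trans ?_
    rw [norm_mul (α : ℂ), norm_mul ((σ : ℂ) * Complex.I * (ω : ℂ) * (ρ : ℂ))]
    gcongr
    · exact hle1 x hx t ht
    · exact hle2 x hx t ht
  · filter_upwards [ae_restrict_mem measurableSet_Ioi] with t ht x hx
    have h2 := HasDerivAt.comp_of_eq x (hasDerivAt_oscPow σ ω ρ α
      (rayPt_mem_slitPlane hσ hρ (le_of_lt ht) (Or.inr ht))) (hasDerivAt_rayPt_left σ ρ x t) rfl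
    refine ((h2.const_mul (((t : ℂ) * edir σ ρ) ^ n)).mul_const (edir σ ρ)).congr_deriv ?_
    ring

lemma continuousOn_rayMoment {σ ω ρ α : ℝ} (hσ : σ = 1 ∨ σ = -1) (hω : 0 < ω) (hρ : 1 ≤ ρ)
    (n : ℕ) (hα : -1 < α) (hα0 : α ≤ 0) :
    ContinuousOn (rayMoment σ ω ρ n α) (Ici 0) := by
  refine continuousOn_of_dominated (bound := fun t => t ^ ((n : ℝ) + α) * Real.exp (-ω * t ^ ρ))
    (fun s _ => aestronglyMeasurable_ray_integrand hσ hρ n α) (fun s hs => ?_) ?_ ?_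
  · filter_upwards [ae_restrict_mem measurableSet_Ioi] with t ht
    have ht' : 0 < t := ht
    refine (norm_ray_integrand_le hσ hω hρ hs ht n α).trans ?_
    rw [Real.rpow_add ht', Real.rpow_natCast, mul_assoc]
    gcongr ?_ * (?_ * ?_)
    exact Real.rpow_le_rpow_of_nonpos ht' (le_norm_rayPt_right hσ hρ hs ht'.le) hα0
  · have : (0 : ℝ) ≤ n := n.cast_nonneg
    exact integrableOn_rpow_mul_exp_neg_mul_rpow (by linarith) (by linarith) hω
  · filter_upwards [ae_restrict_mem measurableSet_Ioi] with t ht s hs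
    have h2 := HasDerivAt.comp_of_eq s (hasDerivAt_oscPow σ ω ρ α
      (rayPt_mem_slitPlane hσ hρ (le_of_lt ht) (Or.inr ht))) (hasDerivAt_rayPt_left σ ρ s t) rfl
    exact ((h2.const_mul (((t : ℂ) * edir σ ρ) ^ n)).mul_const
      (edir σ ρ)).continuousAt.continuousWithinAt

lemma rayMoment_zero {σ ω ρ α : ℝ} (hσ : σ = 1 ∨ σ = -1) (hω : 0 < ω) (hρ : 1 ≤ ρ)
    (n : ℕ) (hα : -1 < α) :
    rayMoment σ ω ρ n α 0 =
      ((Real.Gamma ((n + α + 1) / ρ) / ρ * ω ^ (-((n + α + 1) / ρ)) : ℝ) : ℂ) *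
        Complex.exp ((σ : ℂ) * Complex.I * ((Real.pi / 2 * ((n + α + 1) / ρ) : ℝ) : ℂ)) := by
  have hρ0 : ρ ≠ 0 := by linarith
  have hn : (0 : ℝ) ≤ n := n.cast_nonneg
  have h1 : ∀ t ∈ Ioi (0 : ℝ),
      ((t : ℂ) * edir σ ρ) ^ n * oscPow σ ω ρ α (rayPt σ ρ 0 t) * edir σ ρ =
      ((t ^ ((n : ℝ) + α) * Real.exp (-ω * t ^ ρ) : ℝ) : ℂ) *
        Complex.exp ((σ : ℂ) * Complex.I * ((Real.pi / 2 * ((n + α + 1) / ρ) : ℝ) : ℂ)) := by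
    intro t ht
    have ht' : 0 < t := ht
    have hz : rayPt σ ρ 0 t = (t : ℂ) * edir σ ρ := by simp [rayPt]
    have hI : Complex.exp (((σ * (Real.pi / (2 * ρ)) * ρ : ℝ) : ℂ) * Complex.I) =
        (σ : ℂ) * Complex.I := by
      have : σ * (Real.pi / (2 * ρ)) * ρ = σ * (Real.pi / 2) := by field_simp
      rw [this]
      rcases hσ with rfl | rfl
      · simp [Complex.exp_pi_div_two_mul_I]
      · simp [Complex.exp_neg, Complex.exp_pi_div_two_mul_I]
    have hσ2 : (σ : ℂ) * σ = 1 := by rcases hσ with rfl | rfl <;> simp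
    rw [hz, oscPow, mul_edir_cpow hσ hρ ht', mul_edir_cpow hσ hρ ht', hI, mul_pow,
      Real.rpow_add ht', Real.rpow_natCast, edir_eq, ← Complex.exp_nat_mul]
    have e1 : (σ : ℂ) * Complex.I * (ω : ℂ) * (((t ^ ρ : ℝ) : ℂ) * ((σ : ℂ) * Complex.I)) =
        ((-ω * t ^ ρ : ℝ) : ℂ) := by
      push_cast
      linear_combination (-(ω : ℂ) * ((t ^ ρ : ℝ) : ℂ)) * hσ2 +
        (σ : ℂ) * σ * ω * ((t ^ ρ : ℝ) : ℂ) * Complex.I_sq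
    rw [e1, ← Complex.ofReal_exp]
    have e2 : Complex.exp ((σ : ℂ) * Complex.I * ((Real.pi / 2 * ((n + α + 1) / ρ) : ℝ) : ℂ)) =
        Complex.exp ((n : ℂ) * (((σ * (Real.pi / (2 * ρ)) : ℝ) : ℂ) * Complex.I)) *
        Complex.exp (((σ * (Real.pi / (2 * ρ)) * α : ℝ) : ℂ) * Complex.I) *
        Complex.exp (((σ * (Real.pi / (2 * ρ)) : ℝ) : ℂ) * Complex.I) := by
      rw [← Complex.exp_add, ← Complex.exp_add]
      congr 1
      push_cast
      have : (ρ : ℂ) ≠ 0 := by exact_mod_cast hρ0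
      field_simp
    rw [e2]
    push_cast
    ring
  rw [rayMoment, setIntegral_congr_fun measurableSet_Ioi h1, integral_mul_const]
  congr 1
  rw [integral_complex_ofReal, integral_rpow_mul_exp_neg_mul_rpow (by linarith) (by linarith) hω]
  congr 1
  rw [neg_div]
  ring

lemma norm_rayMoment_le {σ ω ρ s α : ℝ} (hσ : σ = 1 ∨ σ = -1) (hω : 0 < ω) (hρ : 1 ≤ ρ)
    (hs : 0 < s) (n : ℕ) (hα : α ≤ 0) :
    ‖rayMoment σ ω ρ n α s‖ ≤
      s ^ α * (Real.Gamma ((n + 1) / ρ) / ρ * ω ^ (-((n + 1) / ρ))) := by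
  have hn : (0 : ℝ) ≤ n := n.cast_nonneg
  have h_int : ∫ t in Ioi (0 : ℝ), s ^ α * (t ^ (n : ℝ) * Real.exp (-ω * t ^ ρ)) =
      s ^ α * (Real.Gamma ((n + 1) / ρ) / ρ * ω ^ (-((n + 1) / ρ))) := by
    rw [integral_const_mul, integral_rpow_mul_exp_neg_mul_rpow (by linarith) (by linarith) hω,
      neg_div]
    ring
  rw [← h_int]
  refine norm_integral_le_of_norm_le
    ((integrableOn_rpow_mul_exp_neg_mul_rpow (by linarith) (by linarith) hω).const_mul _) ?_
  filter_upwards [ae_restrict_mem measurableSet_Ioi] with t ht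
  have ht' : 0 < t := ht
  refine (norm_ray_integrand_le hσ hω hρ hs.le ht n α).trans ?_
  have h1 := Real.rpow_le_rpow_of_nonpos hs (le_norm_rayPt_left hσ hρ hs.le ht'.le) hα
  calc t ^ n * (‖rayPt σ ρ s t‖ ^ α * Real.exp (-ω * t ^ ρ))
      ≤ t ^ n * (s ^ α * Real.exp (-ω * t ^ ρ)) := by gcongr
    _ = _ := by rw [Real.rpow_natCast]; ring

lemma norm_oscPow_ofReal {σ ω ρ s : ℝ} (hs : 0 < s) (α : ℝ) :
    ‖oscPow σ ω ρ α s‖ = s ^ α := by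
  rw [oscPow, norm_mul, Complex.norm_cpow_eq_rpow_re_of_pos hs, Complex.ofReal_re,
    ← Complex.ofReal_cpow hs.le, Complex.norm_exp]
  have : ((σ : ℂ) * Complex.I * (ω : ℂ) * ((s ^ ρ : ℝ) : ℂ)).re = 0 := by simp
  rw [this, Real.exp_zero, mul_one]

lemma norm_rayMoment_zero_exponent_le {σ ω ρ s : ℝ} (hσ : σ = 1 ∨ σ = -1) (hω : 0 < ω)
    (hρ : 1 ≤ ρ) (hs : 0 < s) (n : ℕ) :
    ω * ρ * ‖rayMoment σ ω ρ n 0 s‖ ≤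
      n * ‖rayMoment σ ω ρ (n - 1) (1 - ρ) s‖ + (ρ - 1) * ‖rayMoment σ ω ρ n (-ρ) s‖ +
        (0 : ℝ) ^ n * s ^ (1 - ρ) := by
  have h := rayMoment_by_parts hσ hω hρ hs n (1 - ρ)
  have e1 : 1 - ρ - 1 = -ρ := by ring
  have e2 : 1 - ρ + ρ - 1 = 0 := by ring
  rw [e1, e2] at h
  have h' : (σ : ℂ) * Complex.I * (ω : ℂ) * (ρ : ℂ) * rayMoment σ ω ρ n 0 s =
      -((n : ℂ) * rayMoment σ ω ρ (n - 1) (1 - ρ) s) +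
      ((ρ - 1 : ℝ) : ℂ) * rayMoment σ ω ρ n (-ρ) s -
      (0 : ℂ) ^ n * oscPow σ ω ρ (1 - ρ) s := by
    push_cast at h ⊢
    linear_combination h
  have hσn : ‖(σ : ℂ)‖ = 1 := by rcases hσ with rfl | rfl <;> simp
  have h3 := congrArg norm h'
  rw [norm_mul, norm_mul, norm_mul, norm_mul, hσn, Complex.norm_I, one_mul, one_mul,
    Complex.norm_of_nonneg hω.le, Complex.norm_of_nonneg (by linarith : 0 ≤ ρ)] at h3
  rw [h3]
  refine (norm_sub_le _ _).trans ?_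
  refine add_le_add ((norm_add_le _ _).trans ?_) ?_
  · rw [norm_neg, norm_mul, norm_mul, Complex.norm_natCast,
      Complex.norm_of_nonneg (by linarith : 0 ≤ ρ - 1)]
  · rw [norm_mul, norm_pow, norm_zero, norm_oscPow_ofReal hs]

lemma norm_phiN_succ (σ ρ μ : ℝ) (n : ℕ) (s ω : ℝ) :
    ‖phiN σ ρ μ (n + 1) s ω‖ = ‖rayMoment σ ω ρ n (μ - 1) s‖ / n.factorial := by
  rw [phiN_succ_eq, norm_mul, norm_div, norm_pow, norm_neg, norm_one, one_pow,
    Complex.norm_natCast]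
  ring

/-- The uniform estimate of `phiN` for the regular exponent `μ = 1`. -/
lemma norm_phiN_le {σ ω ρ s : ℝ} (hσ : σ = 1 ∨ σ = -1) (hω : 0 < ω) (hρ : 1 ≤ ρ)
    (hs : 0 < s) {N : ℕ} (hN : 1 ≤ N) :
    ‖phiN σ ρ 1 N s ω‖ ≤
      Real.Gamma ((N : ℝ) / ρ) / ((Nat.factorial (N - 1) : ℝ) * ρ) * ω ^ (-((N : ℝ) / ρ)) := by
  obtain ⟨n, rfl⟩ := Nat.exists_eq_add_of_le' hN
  rw [norm_phiN_succ, sub_self]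
  have h := norm_rayMoment_le hσ hω hρ hs n le_rfl
  rw [Real.rpow_zero, one_mul] at h
  rw [div_le_iff₀ (by positivity)]
  refine h.trans (le_of_eq ?_)
  push_cast [Nat.add_sub_cancel]
  have : (n.factorial : ℝ) ≠ 0 := by positivity
  have : ρ ≠ 0 := by linarith
  field_simp

/-- The estimate of `phiN` away from the origin for the regular exponent `μ = 1`. -/
lemma norm_phiN_le_of_pos {σ ω ρ s b c : ℝ} (hσ : σ = 1 ∨ σ = -1) (hω : 0 < ω) (hρ : 1 ≤ ρ)
    (hs : 0 < s) {N : ℕ} (hN : 1 ≤ N)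
    (hb : b = if N = 1 then 1 / ρ
      else Real.Gamma (((N : ℝ) - 1) / ρ) / (ρ ^ 2 * (Nat.factorial (N - 2) : ℝ)))
    (hc : c = if N = 1 then (ρ - 1) * Real.Gamma (1 / ρ) / ρ ^ 2
      else (ρ - 1) * Real.Gamma ((N : ℝ) / ρ) / (ρ ^ 2 * (Nat.factorial (N - 1) : ℝ))) :
    ‖phiN σ ρ 1 N s ω‖ ≤ b * ω ^ (-(1 + ((N : ℝ) - 1) / ρ)) * s ^ (1 - ρ) +
      c * ω ^ (-(1 + (N : ℝ) / ρ)) * s ^ (-ρ) := by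
  obtain ⟨n, rfl⟩ := Nat.exists_eq_add_of_le' hN
  have hρ0 : 0 < ρ := by linarith
  rw [norm_phiN_succ, sub_self]
  have h1 := norm_rayMoment_zero_exponent_le hσ hω hρ hs n
  have h2 := norm_rayMoment_le hσ hω hρ hs (n - 1) (by linarith : 1 - ρ ≤ 0)
  have h3 := norm_rayMoment_le hσ hω hρ hs n (by linarith : -ρ ≤ 0)
  have hω1 : ∀ x : ℝ, ω ^ (-(1 + x)) = ω⁻¹ * ω ^ (-x) := by
    intro x
    rw [neg_add, Real.rpow_add hω, Real.rpow_neg_one]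
  have h4 : ‖rayMoment σ ω ρ n 0 s‖ ≤ (ω * ρ)⁻¹ *
      (n * (s ^ (1 - ρ) * (Real.Gamma (((n - 1 : ℕ) + 1) / ρ) / ρ *
          ω ^ (-(((n - 1 : ℕ) + 1) / ρ)))) +
        (ρ - 1) * (s ^ (-ρ) * (Real.Gamma ((n + 1) / ρ) / ρ * ω ^ (-((n + 1) / ρ)))) +
        (0 : ℝ) ^ n * s ^ (1 - ρ)) := by
    rw [le_inv_mul_iff₀ (by positivity)]
    refine h1.trans ?_
    have : 0 ≤ ρ - 1 := by linarith
    gcongr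
  rw [div_le_iff₀ (by positivity)]
  refine h4.trans (le_of_eq ?_)
  rw [hω1, hω1, hb, hc]
  rcases n with _ | m
  · simp
    field_simp
    ring
  · have hm : (m.factorial : ℝ) ≠ 0 := by positivity
    have hm1 : ((m : ℝ) + 1) ≠ 0 := by positivity
    have e1 : m + 1 + 1 - 2 = m := by omega
    have e2 : ((m : ℝ) + 1 + 1 - 1) = m + 1 := by ring
    simp only [Nat.add_sub_cancel, e1]
    rw [if_neg (by omega), if_neg (by omega), Nat.factorial_succ]
    push_cast
    rw [e2, zero_pow (by omega)]
    field_simp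
    ring

lemma le_interpolation {x K γ ρ a b c : ℝ} (hx : 0 < x) (hK : 0 < K) (hγ0 : 0 < γ)
    (hγ : γ ≤ ρ - 1) (hb : 0 ≤ b) (hc : 0 ≤ c) (ha : 0 ≤ a)
    (hroot : a * K ^ ρ - b * K - c = 0) {y : ℝ} (hy1 : y ≤ a)
    (hy2 : y ≤ b * x ^ (1 - ρ) + c * x ^ (-ρ)) : y ≤ a * K ^ γ * x ^ (-γ) := by
  rcases le_total x K with hxK | hxK
  · have h1 : 1 ≤ K ^ γ * x ^ (-γ) := by
      rw [Real.rpow_neg hx.le, ← div_eq_mul_inv, one_le_div (by positivity)]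
      exact Real.rpow_le_rpow hx.le hxK hγ0.le
    calc y ≤ a * 1 := by linarith
      _ ≤ a * (K ^ γ * x ^ (-γ)) := by gcongr
      _ = _ := by ring
  · have e1 : x ^ (1 - ρ) = x ^ (1 - ρ + γ) * x ^ (-γ) := by
      rw [← Real.rpow_add hx]; ring_nf
    have e2 : x ^ (-ρ) = x ^ (-ρ + γ) * x ^ (-γ) := by
      rw [← Real.rpow_add hx]; ring_nf
    have h1 : x ^ (1 - ρ + γ) ≤ K ^ (1 - ρ + γ) :=
      Real.rpow_le_rpow_of_nonpos hK hxK (by linarith)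
    have h2 : x ^ (-ρ + γ) ≤ K ^ (-ρ + γ) :=
      Real.rpow_le_rpow_of_nonpos hK hxK (by linarith)
    have e3 : K ^ (1 - ρ + γ) = K * K ^ (-ρ + γ) := by
      rw [(by ring : 1 - ρ + γ = 1 + (-ρ + γ)), Real.rpow_add hK, Real.rpow_one]
    have e4 : K ^ γ = K ^ ρ * K ^ (-ρ + γ) := by
      rw [← Real.rpow_add hK]; ring_nf
    calc y ≤ b * (x ^ (1 - ρ + γ) * x ^ (-γ)) + c * (x ^ (-ρ + γ) * x ^ (-γ)) := by
          rw [← e1, ← e2]; exact hy2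
      _ ≤ b * (K ^ (1 - ρ + γ) * x ^ (-γ)) + c * (K ^ (-ρ + γ) * x ^ (-γ)) := by gcongr
      _ = a * K ^ γ * x ^ (-γ) := by
          rw [e3, e4]
          linear_combination (-(K ^ (-ρ + γ) * x ^ (-γ))) * hroot

/-- The interpolated estimate of `phiN` for the regular exponent `μ = 1`. -/
lemma norm_phiN_le_interpolated {σ ω ρ s a b c K γ : ℝ} (hσ : σ = 1 ∨ σ = -1) (hω : 0 < ω)
    (hρ : 2 ≤ ρ) (hs : 0 < s) {N : ℕ} (hN : 1 ≤ N) (hγ : γ ∈ Ioo (0 : ℝ) 1)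
    (ha : a = Real.Gamma ((N : ℝ) / ρ) / ((Nat.factorial (N - 1) : ℝ) * ρ))
    (hb : b = if N = 1 then 1 / ρ
      else Real.Gamma (((N : ℝ) - 1) / ρ) / (ρ ^ 2 * (Nat.factorial (N - 2) : ℝ)))
    (hc : c = if N = 1 then (ρ - 1) * Real.Gamma (1 / ρ) / ρ ^ 2
      else (ρ - 1) * Real.Gamma ((N : ℝ) / ρ) / (ρ ^ 2 * (Nat.factorial (N - 1) : ℝ)))
    (hK : 0 < K) (hroot : a * K ^ ρ - b * K - c = 0) :
    ‖phiN σ ρ 1 N s ω‖ ≤ a * K ^ γ * s ^ (-γ) * ω ^ (-((γ + (N : ℝ)) / ρ)) := by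
  have hρ0 : 0 < ρ := by linarith
  have hN' : (1 : ℝ) ≤ N := by exact_mod_cast hN
  have h1 := norm_phiN_le hσ hω (by linarith : 1 ≤ ρ) hs hN
  have h2 := norm_phiN_le_of_pos hσ hω (by linarith) hs hN hb hc
  rw [← ha] at h1
  have hG : 0 ≤ Real.Gamma ((N : ℝ) / ρ) := Real.Gamma_nonneg_of_nonneg (by positivity)
  have ha0 : 0 ≤ a := by rw [ha]; positivity
  have hb0 : 0 ≤ b := by
    have : 0 ≤ Real.Gamma (((N : ℝ) - 1) / ρ) :=
      Real.Gamma_nonneg_of_nonneg (div_nonneg (by linarith) hρ0.le)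
    rw [hb]; split_ifs <;> positivity
  have hc0 : 0 ≤ c := by
    have h3 : 0 ≤ Real.Gamma (1 / ρ) := Real.Gamma_nonneg_of_nonneg (by positivity)
    have h4 : 0 ≤ ρ - 1 := by linarith
    rw [hc]; split_ifs <;> positivity
  set W : ℝ := ω ^ (-((N : ℝ) / ρ)) with hW
  have hW0 : 0 < W := Real.rpow_pos_of_pos hω _
  set x : ℝ := s * ω ^ (1 / ρ) with hx
  have hx0 : 0 < x := by positivity
  have hxp : ∀ r : ℝ, x ^ r = s ^ r * ω ^ (r / ρ) := by
    intro r
    rw [hx, Real.mul_rpow hs.le (by positivity), ← Real.rpow_mul hω.le]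
    congr 2
    ring
  have key := le_interpolation (y := ‖phiN σ ρ 1 N s ω‖ / W) hx0 hK hγ.1
    (by linarith [hγ.2]) hb0 hc0 ha0 hroot (by rwa [div_le_iff₀ hW0]) (by
      rw [div_le_iff₀ hW0, hxp, hxp]
      refine h2.trans (le_of_eq ?_)
      have e1 : ω ^ (-(1 + ((N : ℝ) - 1) / ρ)) = ω ^ ((1 - ρ) / ρ) * W := by
        rw [hW, ← Real.rpow_add hω]
        congr 1
        field_simp
        ring
      have e2 : ω ^ (-(1 + (N : ℝ) / ρ)) = ω ^ (-ρ / ρ) * W := by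
        rw [hW, ← Real.rpow_add hω]
        congr 1
        field_simp
        ring
      rw [e1, e2]
      ring)
  rw [div_le_iff₀ hW0, hxp] at key
  refine key.trans (le_of_eq ?_)
  have e3 : ω ^ (-((γ + (N : ℝ)) / ρ)) = ω ^ (-γ / ρ) * W := by
    rw [hW, ← Real.rpow_add hω]
    congr 1
    ring
  rw [e3]
  ring

/-- The successive antiderivatives of `s ↦ s^{μ-1} e^{σ i ω s^ρ}` used in the expansion. -/
noncomputable def phiSeq (σ ω ρ μ : ℝ) : ℕ → ℝ → ℂ
  | 0 => fun s => oscPow σ ω ρ (μ - 1) s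
  | n + 1 => fun s => phiN σ ρ μ (n + 1) s ω

lemma phiSeq_of_one_le (σ ω ρ μ : ℝ) {n : ℕ} (hn : 1 ≤ n) :
    phiSeq σ ω ρ μ n = fun s => phiN σ ρ μ n s ω := by
  obtain ⟨m, rfl⟩ := Nat.exists_eq_add_of_le' hn
  rfl

lemma phiSeq_succ (σ ω ρ μ : ℝ) (n : ℕ) :
    phiSeq σ ω ρ μ (n + 1) =
      fun s => ((-1 : ℂ) ^ (n + 1) / (n.factorial : ℂ)) * rayMoment σ ω ρ n (μ - 1) s := by
  funext s
  exact phiN_succ_eq σ ρ μ n s ω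

lemma hasDerivAt_phiSeq {σ ω ρ μ s : ℝ} (hσ : σ = 1 ∨ σ = -1) (hω : 0 < ω) (hρ : 1 ≤ ρ)
    (hs : 0 < s) (n : ℕ) :
    HasDerivAt (phiSeq σ ω ρ μ (n + 1)) (phiSeq σ ω ρ μ n s) s := by
  rw [phiSeq_succ]
  refine ((hasDerivAt_rayMoment hσ hω hρ hs n (μ - 1)).const_mul _).congr_deriv ?_
  rcases n with _ | m
  · simp [phiSeq]
  · rw [phiSeq_succ]
    have h1 : (m.factorial : ℂ) ≠ 0 := by exact_mod_cast m.factorial_ne_zero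
    have h2 : ((m : ℂ) + 1) ≠ 0 := by exact_mod_cast m.succ_ne_zero
    rw [Nat.factorial_succ, zero_pow (by omega), Nat.add_sub_cancel]
    push_cast
    field_simp
    ring

lemma continuousOn_phiSeq_succ {σ ω ρ μ : ℝ} (hσ : σ = 1 ∨ σ = -1) (hω : 0 < ω) (hρ : 1 ≤ ρ)
    (hμ : μ ∈ Ioc (0 : ℝ) 1) (n : ℕ) : ContinuousOn (phiSeq σ ω ρ μ (n + 1)) (Ici 0) := by
  rw [phiSeq_succ]
  exact continuousOn_const.mul (continuousOn_rayMoment hσ hω hρ n (by linarith [hμ.1])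
    (by linarith [hμ.2]))

lemma intervalIntegrable_phiSeq {σ ω ρ μ S : ℝ} (hσ : σ = 1 ∨ σ = -1) (hω : 0 < ω) (hρ : 1 ≤ ρ)
    (hμ : μ ∈ Ioc (0 : ℝ) 1) (hS : 0 ≤ S) (n : ℕ) :
    IntervalIntegrable (phiSeq σ ω ρ μ n) volume 0 S := by
  rcases n with _ | n
  · have h1 : IntervalIntegrable (fun s : ℝ => s ^ (μ - 1)) volume 0 S :=
      intervalIntegral.intervalIntegrable_rpow' (by linarith [hμ.1])
    rw [intervalIntegrable_iff_integrableOn_Ioc_of_le hS] at h1 ⊢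
    refine Integrable.mono' h1 ?_ ?_
    · refine ContinuousOn.aestronglyMeasurable (fun s hs => ?_) measurableSet_Ioc
      have hs0 : (s : ℂ) ∈ Complex.slitPlane := by
        rw [Complex.ofReal_mem_slitPlane]; exact hs.1
      exact (ContinuousAt.comp (f := fun s : ℝ => (s : ℂ)) (g := oscPow σ ω ρ (μ - 1))
        (hasDerivAt_oscPow σ ω ρ (μ - 1) hs0).continuousAt
        Complex.continuous_ofReal.continuousAt).continuousWithinAt
    · filter_upwards [ae_restrict_mem measurableSet_Ioc] with s hs
      exact (norm_oscPow_ofReal hs.1 _).le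
  · refine ContinuousOn.intervalIntegrable ?_
    rw [uIcc_of_le hS]
    exact (continuousOn_phiSeq_succ hσ hω hρ hμ n).mono Icc_subset_Ici_self

lemma hasDerivAt_iteratedDerivWithin_Icc {h : ℝ → ℂ} {S x : ℝ} {N n : ℕ}
    (hh : ContDiffOn ℝ N h (Icc 0 S)) (hn : n < N) (hx : x ∈ Ioo 0 S) :
    HasDerivAt (iteratedDerivWithin n h (Icc 0 S)) (iteratedDerivWithin (n + 1) h (Icc 0 S) x)
      x := by
  have hS : (0 : ℝ) < S := hx.1.trans hx.2
  have hd := hh.differentiableOn_iteratedDerivWithin (by exact_mod_cast hn)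
    (uniqueDiffOn_Icc hS) x (Ioo_subset_Icc_self hx)
  rw [iteratedDerivWithin_succ]
  exact hd.hasDerivWithinAt.hasDerivAt (Icc_mem_nhds hx.1 hx.2)

lemma integral_phiSeq_step {σ ω ρ μ S : ℝ} (hσ : σ = 1 ∨ σ = -1) (hω : 0 < ω) (hρ : 1 ≤ ρ)
    (hμ : μ ∈ Ioc (0 : ℝ) 1) (hS : 0 < S) {h : ℝ → ℂ} {N n : ℕ}
    (hh : ContDiffOn ℝ N h (Icc 0 S)) (hn : n < N)
    (hhS : iteratedDerivWithin n h (Icc 0 S) S = 0) :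
    ∫ s in (0 : ℝ)..S, phiSeq σ ω ρ μ n s * iteratedDerivWithin n h (Icc 0 S) s =
      -(phiSeq σ ω ρ μ (n + 1) 0 * iteratedDerivWithin n h (Icc 0 S) 0) -
      ∫ s in (0 : ℝ)..S,
        phiSeq σ ω ρ μ (n + 1) s * iteratedDerivWithin (n + 1) h (Icc 0 S) s := by
  have hU : uIcc 0 S = Icc 0 S := uIcc_of_le hS.le
  have hc : ∀ m : ℕ, m ≤ N → ContinuousOn (iteratedDerivWithin m h (Icc 0 S)) (uIcc 0 S) := by
    intro m hm
    rw [hU]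
    exact hh.continuousOn_iteratedDerivWithin (by exact_mod_cast hm) (uniqueDiffOn_Icc hS)
  have key := intervalIntegral.integral_mul_deriv_eq_deriv_mul_of_hasDerivAt
    (hc n hn.le) (v := phiSeq σ ω ρ μ (n + 1))
    (by rw [hU]; exact (continuousOn_phiSeq_succ hσ hω hρ hμ n).mono Icc_subset_Ici_self)
    (fun x hx => hasDerivAt_iteratedDerivWithin_Icc hh hn
      (by rwa [min_eq_left hS.le, max_eq_right hS.le] at hx))
    (fun x hx => hasDerivAt_phiSeq hσ hω hρ
      (by rw [min_eq_left hS.le] at hx; exact hx.1) n)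
    (hc (n + 1) hn).intervalIntegrable
    (intervalIntegrable_phiSeq hσ hω hρ hμ hS.le n)
  rw [hhS, zero_mul, zero_sub] at key
  simp only [mul_comm (phiSeq _ _ _ _ _ _)]
  exact key

lemma integral_phiSeq_expansion {σ ω ρ μ S : ℝ} (hσ : σ = 1 ∨ σ = -1) (hω : 0 < ω) (hρ : 1 ≤ ρ)
    (hμ : μ ∈ Ioc (0 : ℝ) 1) (hS : 0 < S) {h : ℝ → ℂ} {N : ℕ}
    (hh : ContDiffOn ℝ N h (Icc 0 S))
    (hhS : ∀ n < N, iteratedDerivWithin n h (Icc 0 S) S = 0) (M : ℕ) (hM : M ≤ N) :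
    ∫ s in (0 : ℝ)..S, phiSeq σ ω ρ μ 0 s * h s =
      ∑ n ∈ Finset.range M, (-1 : ℂ) ^ (n + 1) * phiSeq σ ω ρ μ (n + 1) 0 *
        iteratedDerivWithin n h (Icc 0 S) 0 +
      (-1 : ℂ) ^ M * ∫ s in (0 : ℝ)..S,
        phiSeq σ ω ρ μ M s * iteratedDerivWithin M h (Icc 0 S) s := by
  induction M with
  | zero => simp
  | succ M ih =>
    rw [ih (by omega), integral_phiSeq_step hσ hω hρ hμ hS hh hM (hhS M hM),
      Finset.sum_range_succ]
    ring

lemma phiSeq_zero_eq_theta {σ ω ρ μ : ℝ} (hσ : σ = 1 ∨ σ = -1) (hω : 0 < ω) (hρ : 1 ≤ ρ)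
    (hμ : μ ∈ Ioc (0 : ℝ) 1) (n : ℕ) :
    (-1 : ℂ) ^ (n + 1) * phiSeq σ ω ρ μ (n + 1) 0 =
      (σ : ℂ) * theta σ ρ μ n * ((ω ^ (-(((n : ℝ) + μ) / ρ)) : ℝ) : ℂ) := by
  have hσ2 : (σ : ℂ) * σ = 1 := by rcases hσ with rfl | rfl <;> simp
  have h1 : (-1 : ℂ) ^ (n + 1) * (-1 : ℂ) ^ (n + 1) = 1 := by
    rw [← mul_pow]; simp
  rw [phiSeq_succ]
  simp only []
  rw [rayMoment_zero hσ hω hρ n (by linarith [hμ.1]), theta]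
  have e : (n : ℝ) + (μ - 1) + 1 = n + μ := by ring
  rw [e]
  have h2 : (n.factorial : ℂ) ≠ 0 := by exact_mod_cast n.factorial_ne_zero
  have h3 : (ρ : ℂ) ≠ 0 := by
    have : ρ ≠ 0 := by linarith
    exact_mod_cast this
  rw [Complex.ofReal_mul, Complex.ofReal_div]
  generalize Complex.exp _ = E
  generalize ((ω ^ (-(((n : ℝ) + μ) / ρ)) : ℝ) : ℂ) = W
  generalize ((Real.Gamma (((n : ℝ) + μ) / ρ) : ℝ) : ℂ) = G
  generalize (-1 : ℂ) ^ (n + 1) = s at h1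
  field_simp
  linear_combination G * W * E * h1 - G * W * E * hσ2

/-- The asymptotic expansion with exact remainder of an oscillatory integral with a power phase. -/
lemma integral_power_phase_expansion {σ ω ρ μ S : ℝ} (hσ : σ = 1 ∨ σ = -1) (hω : 0 < ω)
    (hρ : 1 ≤ ρ) (hμ : μ ∈ Ioc (0 : ℝ) 1) (hS : 0 < S) {h : ℝ → ℂ} {N : ℕ} (hN : 1 ≤ N)
    (hh : ContDiffOn ℝ N h (Icc 0 S))
    (hhS : ∀ n < N, iteratedDerivWithin n h (Icc 0 S) S = 0) :
    ∫ s in (0 : ℝ)..S, oscPow σ ω ρ (μ - 1) s * h s =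
      (σ : ℂ) * ∑ n ∈ Finset.range N, theta σ ρ μ n * iteratedDerivWithin n h (Icc 0 S) 0 *
        ((ω ^ (-(((n : ℝ) + μ) / ρ)) : ℝ) : ℂ) +
      (-1 : ℂ) ^ N * ∫ s in (0 : ℝ)..S,
        phiN σ ρ μ N s ω * iteratedDerivWithin N h (Icc 0 S) s := by
  have key := integral_phiSeq_expansion hσ hω hρ hμ hS hh hhS N le_rfl
  rw [phiSeq_of_one_le σ ω ρ μ hN] at key
  refine key.trans ?_
  congr 1
  rw [Finset.mul_sum]
  refine Finset.sum_congr rfl fun n _ => ?_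
  rw [phiSeq_zero_eq_theta hσ hω hρ hμ]
  ring

/-- The substitution `s = φ p = (ψ p - ψ p1) ^ (1 / ρ)` on `[p1, p2 - η]` with inverse `g`, for a
phase `ψ` which increases on `[p1, p2]` and is `C^N` with positive derivative in the interior. -/
structure IsEndpointChart (p1 p2 η ρ S : ℝ) (N : ℕ) (ψ φ g : ℝ → ℝ) : Prop where
  one_le_order : 1 ≤ N
  lt : p1 < p2
  cut_mem : η ∈ Ioo (0 : ℝ) ((p2 - p1) / 2)
  one_le_exponent : 1 ≤ ρ
  continuousOn : ContinuousOn ψ (Icc p1 p2)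
  contDiffOn : ContDiffOn ℝ N ψ (Ioo p1 p2)
  deriv_pos : ∀ p ∈ Ioo p1 p2, 0 < deriv ψ p
  chart_eq : ∀ p ∈ Icc p1 (p2 - η), φ p = (ψ p - ψ p1) ^ (1 / ρ)
  end_eq : S = φ (p2 - η)
  left_inv : ∀ p ∈ Icc p1 (p2 - η), g (φ p) = p
  right_inv : ∀ s ∈ Icc 0 S, φ (g s) = s
  mapsTo : ∀ s ∈ Icc 0 S, g s ∈ Icc p1 (p2 - η)

namespace IsEndpointChart

variable {p1 p2 η ρ S : ℝ} {N : ℕ} {ψ φ g : ℝ → ℝ}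

lemma left_lt_cut (h : IsEndpointChart p1 p2 η ρ S N ψ φ g) : p1 < p2 - η := by
  linarith [h.cut_mem.1, h.cut_mem.2, h.lt]

lemma cut_lt_right (h : IsEndpointChart p1 p2 η ρ S N ψ φ g) : p2 - η < p2 := by
  linarith [h.cut_mem.1]

lemma exponent_pos (h : IsEndpointChart p1 p2 η ρ S N ψ φ g) : 0 < ρ := by
  linarith [h.one_le_exponent]

lemma Icc_subset (h : IsEndpointChart p1 p2 η ρ S N ψ φ g) : Icc p1 (p2 - η) ⊆ Icc p1 p2 :=
  Icc_subset_Icc_right h.cut_lt_right.le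

lemma strictMonoOn_phase (h : IsEndpointChart p1 p2 η ρ S N ψ φ g) :
    StrictMonoOn ψ (Icc p1 p2) := by
  refine strictMonoOn_of_deriv_pos (convex_Icc _ _) h.continuousOn fun p hp => ?_
  rw [interior_Icc] at hp
  exact h.deriv_pos p hp

lemma phase_sub_nonneg (h : IsEndpointChart p1 p2 η ρ S N ψ φ g) {p : ℝ} (hp : p ∈ Icc p1 p2) :
    0 ≤ ψ p - ψ p1 :=
  sub_nonneg.2 (h.strictMonoOn_phase.monotoneOn (left_mem_Icc.2 h.lt.le) hp hp.1)

lemma strictMonoOn_chart (h : IsEndpointChart p1 p2 η ρ S N ψ φ g) :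
    StrictMonoOn φ (Icc p1 (p2 - η)) := by
  intro p hp q hq hpq
  rw [h.chart_eq p hp, h.chart_eq q hq]
  refine Real.rpow_lt_rpow (h.phase_sub_nonneg (h.Icc_subset hp)) ?_ (one_div_pos.2 h.exponent_pos)
  linarith [h.strictMonoOn_phase (h.Icc_subset hp) (h.Icc_subset hq) hpq]

lemma chart_left (h : IsEndpointChart p1 p2 η ρ S N ψ φ g) : φ p1 = 0 := by
  rw [h.chart_eq p1 (left_mem_Icc.2 h.left_lt_cut.le), sub_self,
    Real.zero_rpow (one_div_pos.2 h.exponent_pos).ne']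

lemma end_pos (h : IsEndpointChart p1 p2 η ρ S N ψ φ g) : 0 < S := by
  rw [h.end_eq, ← h.chart_left]
  exact h.strictMonoOn_chart (left_mem_Icc.2 h.left_lt_cut.le)
    (right_mem_Icc.2 h.left_lt_cut.le) h.left_lt_cut

lemma inv_zero (h : IsEndpointChart p1 p2 η ρ S N ψ φ g) : g 0 = p1 := by
  rw [← h.chart_left]
  exact h.left_inv p1 (left_mem_Icc.2 h.left_lt_cut.le)

lemma inv_end (h : IsEndpointChart p1 p2 η ρ S N ψ φ g) : g S = p2 - η := by
  rw [h.end_eq]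
  exact h.left_inv _ (right_mem_Icc.2 h.left_lt_cut.le)

lemma strictMonoOn_inv (h : IsEndpointChart p1 p2 η ρ S N ψ φ g) :
    StrictMonoOn g (Icc 0 S) := by
  intro s hs t ht hst
  rw [← h.strictMonoOn_chart.lt_iff_lt (h.mapsTo s hs) (h.mapsTo t ht), h.right_inv s hs,
    h.right_inv t ht]
  exact hst

lemma inv_mem_Ioo (h : IsEndpointChart p1 p2 η ρ S N ψ φ g) {s : ℝ} (hs : s ∈ Ioc 0 S) :
    g s ∈ Ioo p1 p2 := by
  refine ⟨?_, (h.mapsTo s (Ioc_subset_Icc_self hs)).2.trans_lt h.cut_lt_right⟩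
  rw [← h.inv_zero]
  exact h.strictMonoOn_inv (left_mem_Icc.2 h.end_pos.le) (Ioc_subset_Icc_self hs) hs.1

lemma image_inv (h : IsEndpointChart p1 p2 η ρ S N ψ φ g) :
    g '' Ioo 0 S = Ioo p1 (p2 - η) := by
  have h0 : (0 : ℝ) ∈ Icc 0 S := left_mem_Icc.2 h.end_pos.le
  have hS : S ∈ Icc 0 S := right_mem_Icc.2 h.end_pos.le
  have hl : p1 ∈ Icc p1 (p2 - η) := left_mem_Icc.2 h.left_lt_cut.le
  have hr : p2 - η ∈ Icc p1 (p2 - η) := right_mem_Icc.2 h.left_lt_cut.le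
  ext p
  constructor
  · rintro ⟨s, hs, rfl⟩
    rw [← h.inv_end]
    refine ⟨?_, h.strictMonoOn_inv (Ioo_subset_Icc_self hs) hS hs.2⟩
    nth_rewrite 1 [← h.inv_zero]
    exact h.strictMonoOn_inv h0 (Ioo_subset_Icc_self hs) hs.1
  · intro hp
    have hp' := Ioo_subset_Icc_self hp
    refine ⟨φ p, ⟨?_, ?_⟩, h.left_inv p hp'⟩
    · rw [← h.chart_left]
      exact h.strictMonoOn_chart hl hp' hp.1
    · rw [h.end_eq]
      exact h.strictMonoOn_chart hp' hr hp.2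

lemma phase_inv (h : IsEndpointChart p1 p2 η ρ S N ψ φ g) {s : ℝ} (hs : s ∈ Icc 0 S) :
    ψ (g s) = ψ p1 + s ^ ρ := by
  have h1 := h.right_inv s hs
  rw [h.chart_eq _ (h.mapsTo s hs)] at h1
  have h2 := h.phase_sub_nonneg (h.Icc_subset (h.mapsTo s hs))
  have h3 : s ^ ρ = ψ (g s) - ψ p1 := by
    nth_rewrite 1 [← h1]
    rw [← Real.rpow_mul h2, one_div_mul_cancel h.exponent_pos.ne', Real.rpow_one]
  linarith

lemma contDiffWithinAt_inv (h : IsEndpointChart p1 p2 η ρ S N ψ φ g) {s : ℝ} (hs : s ∈ Ioc 0 S) :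
    ContDiffWithinAt ℝ N g (Icc 0 S) s := by
  have hs' := Ioc_subset_Icc_self hs
  have hN : ((N : ℕ∞) : WithTop ℕ∞) ≠ 0 := by
    have := h.one_le_order
    exact_mod_cast (by omega : N ≠ 0)
  set Φ : ℝ → ℝ := fun p => (ψ p - ψ p1) ^ (1 / ρ) with hΦ
  have hp := h.inv_mem_Ioo hs
  have hψ : ContDiffAt ℝ N ψ (g s) := h.contDiffOn.contDiffAt (isOpen_Ioo.mem_nhds hp)
  have hpos : 0 < ψ (g s) - ψ p1 := by
    rw [h.phase_inv hs', add_sub_cancel_left]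
    exact Real.rpow_pos_of_pos hs.1 _
  have hΦC : ContDiffAt ℝ N Φ (g s) := (hψ.sub contDiffAt_const).rpow_const_of_ne hpos.ne'
  have hΦd : HasDerivAt Φ (deriv ψ (g s) * (1 / ρ) * (ψ (g s) - ψ p1) ^ (1 / ρ - 1)) (g s) :=
    ((hψ.differentiableAt hN).hasDerivAt.sub_const _).rpow_const (Or.inl hpos.ne')
  have hne : deriv ψ (g s) * (1 / ρ) * (ψ (g s) - ψ p1) ^ (1 / ρ - 1) ≠ 0 :=
    (mul_pos (mul_pos (h.deriv_pos _ hp) (one_div_pos.2 h.exponent_pos))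
      (Real.rpow_pos_of_pos hpos _)).ne'
  have hf := hΦd.hasFDerivAt_equiv hne
  have hΦs : Φ (g s) = s := by
    rw [hΦ]
    simp only
    rw [← h.chart_eq _ (h.mapsTo s hs'), h.right_inv s hs']
  have hLC := hΦC.to_localInverse hf hN
  have hL0 := hΦC.localInverse_apply_image hf hN
  have hstrict := hΦC.hasStrictFDerivAt' hf hN
  have hright := hstrict.eventually_right_inverse
  have hLdef : hΦC.localInverse hf hN = hstrict.localInverse Φ _ (g s) := rfl
  set L := hΦC.localInverse hf hN with hL
  rw [hΦs] at hLC hL0 hright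
  rw [← hLdef] at hright
  have hLcont : Filter.Tendsto L (nhds s) (nhds (g s)) := by
    have := hLC.continuousAt
    rwa [ContinuousAt, hL0] at this
  have hev : ∀ᶠ t in nhds s, L t ∈ Ioo p1 p2 := hLcont.eventually (isOpen_Ioo.mem_nhds hp)
  refine hLC.contDiffWithinAt.congr_of_eventuallyEq ?_ hL0.symm
  filter_upwards [mem_nhdsWithin_of_mem_nhds hev, mem_nhdsWithin_of_mem_nhds hright,
    self_mem_nhdsWithin] with t ht1 ht2 ht3
  have hLt : L t ∈ Icc p1 (p2 - η) := by
    refine ⟨ht1.1.le, ?_⟩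
    by_contra! hlt
    have h1 : Φ (p2 - η) < Φ (L t) := by
      refine Real.rpow_lt_rpow (h.phase_sub_nonneg ⟨h.left_lt_cut.le, h.cut_lt_right.le⟩) ?_
        (one_div_pos.2 h.exponent_pos)
      linarith [h.strictMonoOn_phase ⟨h.left_lt_cut.le, h.cut_lt_right.le⟩
        (Ioo_subset_Icc_self ht1) hlt]
    have h2 : Φ (p2 - η) = S := by
      rw [h.end_eq, h.chart_eq _ (right_mem_Icc.2 h.left_lt_cut.le)]
    change Φ (L t) = t at ht2
    linarith [ht3.2]
  have h3 : φ (L t) = t := by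
    rw [h.chart_eq _ hLt]
    exact ht2
  rw [← h.left_inv _ hLt, h3]

end IsEndpointChart

lemma iteratedFDerivWithin_comp_eq_zero {c : ℝ → ℂ} {g : ℝ → ℝ} {t : Set ℝ} {x : ℝ} {N n : ℕ}
    (hc : ContDiff ℝ N c) (hg : ContDiffOn ℝ N g t) (ht : UniqueDiffOn ℝ t) (hx : x ∈ t)
    (hn : n ≤ N) (h0 : ∀ i ≤ n, iteratedDeriv i c (g x) = 0) :
    iteratedFDerivWithin ℝ n (fun s => c (g s)) t x = 0 := by
  set D : ℝ := 1 + ∑ i ∈ Finset.range (n + 1), ‖iteratedFDerivWithin ℝ i g t x‖ with hD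
  have hD1 : 1 ≤ D := by
    rw [hD, le_add_iff_nonneg_right]
    exact Finset.sum_nonneg fun i _ => norm_nonneg _
  have h := norm_iteratedFDerivWithin_comp_le (C := 0) (D := D) (n := n)
    (contDiffOn_univ.2 hc) hg (by exact_mod_cast hn) uniqueDiffOn_univ ht (mapsTo_univ _ _) hx
    (fun i hi => by
      rw [iteratedFDerivWithin_univ, norm_iteratedFDeriv_eq_norm_iteratedDeriv, h0 i hi, norm_zero])
    (fun i hi hin => by
      refine le_trans ?_ (le_self_pow₀ hD1 (by omega))
      have := Finset.single_le_sum (f := fun i => ‖iteratedFDerivWithin ℝ i g t x‖)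
        (fun i _ => norm_nonneg _) (Finset.mem_range.2 (by omega : i < n + 1))
      linarith)
  rw [mul_zero, zero_mul] at h
  exact norm_le_zero_iff.1 h

lemma iteratedDerivWithin_comp_mul_eq_zero {c k : ℝ → ℂ} {g : ℝ → ℝ} {t : Set ℝ} {x : ℝ}
    {N n : ℕ} (hc : ContDiff ℝ N c) (hg : ContDiffOn ℝ N g t) (hk : ContDiffOn ℝ N k t)
    (ht : UniqueDiffOn ℝ t) (hx : x ∈ t) (hn : n ≤ N)
    (h0 : ∀ i ≤ n, iteratedDeriv i c (g x) = 0) :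
    iteratedDerivWithin n (fun s => c (g s) * k s) t x = 0 := by
  have h := norm_iteratedFDerivWithin_mul_le (hc.comp_contDiffOn hg) hk ht hx
    (n := n) (by exact_mod_cast hn)
  rw [Finset.sum_eq_zero, norm_iteratedFDerivWithin_eq_norm_iteratedDerivWithin] at h
  · exact norm_le_zero_iff.1 h
  · intro i hi
    have hi' : i ≤ n := by
      have := Finset.mem_range.1 hi
      omega
    have h1 : iteratedFDerivWithin ℝ i (c ∘ g) t x = 0 :=
      iteratedFDerivWithin_comp_eq_zero (c := c) (g := g) hc hg ht hx (hi'.trans hn)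
        fun m hm => h0 m (hm.trans hi')
    rw [h1, norm_zero, mul_zero, zero_mul]

/-- A smooth function equal to `1` on `[p1, p1 + η]` and to `0` on `[p2 - η, p2]`. -/
structure IsCutoff (p1 p2 η : ℝ) (ν : ℝ → ℝ) : Prop where
  contDiff : ContDiff ℝ (⊤ : ℕ∞) ν
  eq_one : ∀ p ∈ Icc p1 (p1 + η), ν p = 1
  eq_zero : ∀ p ∈ Icc (p2 - η) p2, ν p = 0

lemma IsCutoff.contDiff_ofReal {p1 p2 η : ℝ} {ν : ℝ → ℝ} (hν : IsCutoff p1 p2 η ν) (N : ℕ) :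
    ContDiff ℝ N (fun p => ((ν p : ℝ) : ℂ)) :=
  Complex.ofRealCLM.contDiff.comp (hν.contDiff.of_le (by exact_mod_cast le_top))

lemma IsCutoff.iteratedDeriv_eq_zero {p1 p2 η : ℝ} {ν : ℝ → ℝ} (hν : IsCutoff p1 p2 η ν)
    (hη : 0 < η) (n : ℕ) : iteratedDeriv n (fun p => ((ν p : ℝ) : ℂ)) (p2 - η) = 0 := by
  have hm : p2 - η ∈ Icc (p2 - η) p2 := ⟨le_rfl, by linarith⟩
  rw [← iteratedDerivWithin_eq_iteratedDeriv (uniqueDiffOn_Icc (by linarith : p2 - η < p2))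
    (hν.contDiff_ofReal n).contDiffAt hm,
    iteratedDerivWithin_congr (g := fun _ => (0 : ℂ)) (fun p hp => by simp [hν.eq_zero p hp]) hm,
    iteratedDerivWithin_const]
  simp

namespace IsEndpointChart

variable {p1 p2 η ρ S : ℝ} {N : ℕ} {ψ φ g ν : ℝ → ℝ} {k : ℝ → ℂ}

lemma cutoff_inv_eventuallyEq (h : IsEndpointChart p1 p2 η ρ S N ψ φ g)
    (hν : IsCutoff p1 p2 η ν) :
    (fun s => ν (g s)) =ᶠ[nhdsWithin 0 (Icc 0 S)] fun _ => 1 := by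
  have hη := h.cut_mem
  have hm : p1 + η ∈ Icc p1 (p2 - η) := ⟨by linarith [hη.1], by linarith [hη.2]⟩
  have hpos : 0 < φ (p1 + η) := by
    rw [← h.chart_left]
    exact h.strictMonoOn_chart (left_mem_Icc.2 h.left_lt_cut.le) hm (by linarith [hη.1])
  filter_upwards [self_mem_nhdsWithin, mem_nhdsWithin_of_mem_nhds (Iio_mem_nhds hpos)]
    with s hs hs'
  refine hν.eq_one _ ⟨(h.mapsTo s hs).1, ?_⟩
  rw [← h.strictMonoOn_chart.le_iff_le (h.mapsTo s hs) hm, h.right_inv s hs]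
  exact hs'.le

lemma cutoff_inv_zero (h : IsEndpointChart p1 p2 η ρ S N ψ φ g) (hν : IsCutoff p1 p2 η ν) :
    ν (g 0) = 1 := by
  rw [h.inv_zero]
  exact hν.eq_one _ ⟨le_rfl, by linarith [h.cut_mem.1]⟩

lemma contDiffOn_cutoff_mul (h : IsEndpointChart p1 p2 η ρ S N ψ φ g) (hν : IsCutoff p1 p2 η ν)
    (hk : ContDiffOn ℝ N k (Icc 0 S)) :
    ContDiffOn ℝ N (fun s => ((ν (g s) : ℝ) : ℂ) * k s) (Icc 0 S) := by
  refine ContDiffOn.mul (fun s hs => ?_) hk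
  rcases hs.1.eq_or_lt with rfl | hs0
  · have he := h.cutoff_inv_eventuallyEq hν
    refine (contDiffWithinAt_const (c := (1 : ℂ))).congr_of_eventuallyEq ?_ ?_
    · filter_upwards [he] with t ht
      rw [ht, Complex.ofReal_one]
    · rw [h.cutoff_inv_zero hν, Complex.ofReal_one]
  · exact (hν.contDiff_ofReal N).contDiffAt.comp_contDiffWithinAt s
      (h.contDiffWithinAt_inv ⟨hs0, hs.2⟩)

lemma iteratedDerivWithin_cutoff_mul_zero (h : IsEndpointChart p1 p2 η ρ S N ψ φ g)
    (hν : IsCutoff p1 p2 η ν) (n : ℕ) :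
    iteratedDerivWithin n (fun s => ((ν (g s) : ℝ) : ℂ) * k s) (Icc 0 S) 0 =
      iteratedDerivWithin n k (Icc 0 S) 0 := by
  have he := h.cutoff_inv_eventuallyEq hν
  refine Filter.EventuallyEq.iteratedDerivWithin_eq ?_ ?_
  · filter_upwards [he] with t ht
    rw [ht, Complex.ofReal_one, one_mul]
  · rw [h.cutoff_inv_zero hν, Complex.ofReal_one, one_mul]

lemma iteratedDerivWithin_cutoff_mul_end (h : IsEndpointChart p1 p2 η ρ S N ψ φ g)
    (hν : IsCutoff p1 p2 η ν) (hk : ContDiffOn ℝ N k (Icc 0 S)) {n : ℕ} (hn : n ≤ N) :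
    iteratedDerivWithin n (fun s => ((ν (g s) : ℝ) : ℂ) * k s) (Icc 0 S) S = 0 := by
  have hS := h.end_pos
  have hsub : Icc (S / 2) S ⊆ Icc 0 S := Icc_subset_Icc_left (by linarith)
  have hset : Icc 0 S =ᶠ[nhds S] Icc (S / 2) S := by
    filter_upwards [Ioi_mem_nhds (by linarith : S / 2 < S)] with t ht
    have ht' : S / 2 < t := ht
    exact propext ⟨fun hm => ⟨ht'.le, hm.2⟩, fun hm => hsub hm⟩
  rw [iteratedDerivWithin_eq_iteratedFDerivWithin, iteratedFDerivWithin_congr_set hset,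
    ← iteratedDerivWithin_eq_iteratedFDerivWithin]
  refine iteratedDerivWithin_comp_mul_eq_zero (c := fun p => ((ν p : ℝ) : ℂ))
    (hν.contDiff_ofReal N) (fun s hs => ?_) (hk.mono hsub) (uniqueDiffOn_Icc (by linarith))
    (right_mem_Icc.2 (by linarith)) hn fun i _ => ?_
  · exact (h.contDiffWithinAt_inv ⟨by linarith [hs.1], hs.2⟩).mono hsub
  · rw [h.inv_end]
    exact hν.iteratedDeriv_eq_zero h.cut_mem.1 i

end IsEndpointChart

namespace IsEndpointChart

variable {p1 p2 η ρ S σ ω μ : ℝ} {N : ℕ} {ψ φ g ν : ℝ → ℝ} {U k : ℝ → ℂ}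

lemma pullback_eq (h : IsEndpointChart p1 p2 η ρ S N ψ φ g)
    (hkU : ∀ s ∈ Ioc 0 S, k s = U (g s) * ((s ^ (1 - μ) : ℝ) : ℂ) *
      ((derivWithin g (Icc 0 S) s : ℝ) : ℂ)) {s : ℝ} (hs : s ∈ Ioo 0 S) :
    |derivWithin g (Icc 0 S) s| • (((ν (g s) : ℝ) : ℂ) *
        (U (g s) * Complex.exp (Complex.I * ((σ * ω * ψ (g s) : ℝ) : ℂ)))) =
      Complex.exp (Complex.I * ((σ * ω * ψ p1 : ℝ) : ℂ)) *
        (oscPow σ ω ρ (μ - 1) s * (((ν (g s) : ℝ) : ℂ) * k s)) := by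
  have h1 : s ^ (μ - 1) * s ^ (1 - μ) = 1 := by
    rw [← Real.rpow_add hs.1, sub_add_sub_cancel', sub_self, Real.rpow_zero]
  have h1' : ((s ^ (μ - 1) : ℝ) : ℂ) * ((s ^ (1 - μ) : ℝ) : ℂ) = 1 := by
    rw [← Complex.ofReal_mul, h1, Complex.ofReal_one]
  have h2 : Complex.exp (Complex.I * ((σ * ω * ψ (g s) : ℝ) : ℂ)) =
      Complex.exp (Complex.I * ((σ * ω * ψ p1 : ℝ) : ℂ)) *
        Complex.exp ((σ : ℂ) * Complex.I * (ω : ℂ) * ((s ^ ρ : ℝ) : ℂ)) := by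
    rw [← Complex.exp_add, h.phase_inv (Ioo_subset_Icc_self hs)]
    congr 1
    push_cast
    ring
  rw [abs_of_nonneg h.strictMonoOn_inv.monotoneOn.derivWithin_nonneg, h2,
    hkU s (Ioo_subset_Ioc_self hs), oscPow, ← Complex.ofReal_cpow hs.1.le,
    ← Complex.ofReal_cpow hs.1.le, Complex.real_smul]
  linear_combination (-(((derivWithin g (Icc 0 S) s : ℝ) : ℂ) * ((ν (g s) : ℝ) : ℂ) * U (g s) *
    Complex.exp (Complex.I * ((σ * ω * ψ p1 : ℝ) : ℂ)) *
    Complex.exp ((σ : ℂ) * Complex.I * (ω : ℂ) * ((s ^ ρ : ℝ) : ℂ)))) * h1'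

lemma hasDerivWithinAt_inv (h : IsEndpointChart p1 p2 η ρ S N ψ φ g) {s : ℝ} (hs : s ∈ Ioo 0 S) :
    HasDerivWithinAt g (derivWithin g (Icc 0 S) s) (Ioo 0 S) s := by
  have hN : ((N : ℕ∞) : WithTop ℕ∞) ≠ 0 := by
    have := h.one_le_order
    exact_mod_cast (by omega : N ≠ 0)
  exact ((h.contDiffWithinAt_inv (Ioo_subset_Ioc_self hs)).differentiableWithinAt
    hN).hasDerivWithinAt.mono Ioo_subset_Icc_self

theorem intervalIntegrable_and_integral_cutoff (h : IsEndpointChart p1 p2 η ρ S N ψ φ g)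
    (hν : IsCutoff p1 p2 η ν) (hσ : σ = 1 ∨ σ = -1) (hω : 0 < ω) (hμ : μ ∈ Ioc (0 : ℝ) 1)
    (hk : ContDiffOn ℝ N k (Icc 0 S))
    (hkU : ∀ s ∈ Ioc 0 S, k s = U (g s) * ((s ^ (1 - μ) : ℝ) : ℂ) *
      ((derivWithin g (Icc 0 S) s : ℝ) : ℂ)) :
    IntervalIntegrable (fun p => ((ν p : ℝ) : ℂ) *
        (U p * Complex.exp (Complex.I * ((σ * ω * ψ p : ℝ) : ℂ)))) volume p1 p2 ∧
      ∫ p in p1..p2, ((ν p : ℝ) : ℂ) *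
          (U p * Complex.exp (Complex.I * ((σ * ω * ψ p : ℝ) : ℂ))) =
        Complex.exp (Complex.I * ((σ * ω * ψ p1 : ℝ) : ℂ)) *
          ∫ s in (0 : ℝ)..S, oscPow σ ω ρ (μ - 1) s * (((ν (g s) : ℝ) : ℂ) * k s) := by
  have hS := h.end_pos
  have hinj : InjOn g (Ioo 0 S) := h.strictMonoOn_inv.injOn.mono Ioo_subset_Icc_self
  set F : ℝ → ℂ := fun p => ((ν p : ℝ) : ℂ) *
    (U p * Complex.exp (Complex.I * ((σ * ω * ψ p : ℝ) : ℂ))) with hF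
  set G : ℝ → ℂ := fun s => Complex.exp (Complex.I * ((σ * ω * ψ p1 : ℝ) : ℂ)) *
    (oscPow σ ω ρ (μ - 1) s * (((ν (g s) : ℝ) : ℂ) * k s)) with hG
  have hpull : EqOn (fun s => |derivWithin g (Icc 0 S) s| • F (g s)) G (Ioo 0 S) :=
    fun s hs => h.pullback_eq hkU hs
  have hGint : IntervalIntegrable G volume 0 S := by
    refine IntervalIntegrable.const_mul ?_ _
    refine (intervalIntegrable_phiSeq hσ hω h.one_le_exponent hμ hS.le 0).mul_continuousOn ?_
    rw [uIcc_of_le hS.le]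
    exact (h.contDiffOn_cutoff_mul hν hk).continuousOn
  have hzero : EqOn F 0 (Icc (p2 - η) p2) := fun p hp => by simp [hF, hν.eq_zero p hp]
  have hFl : IntervalIntegrable F volume p1 (p2 - η) := by
    rw [intervalIntegrable_iff_integrableOn_Ioo_of_le h.left_lt_cut.le, ← h.image_inv,
      integrableOn_image_iff_integrableOn_abs_deriv_smul measurableSet_Ioo
        (fun s hs => h.hasDerivWithinAt_inv hs) hinj,
      integrableOn_congr_fun hpull measurableSet_Ioo,
      ← intervalIntegrable_iff_integrableOn_Ioo_of_le hS.le]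
    exact hGint
  have hFr : IntervalIntegrable F volume (p2 - η) p2 := by
    refine (intervalIntegrable_const (c := (0 : ℂ))).congr ?_
    rw [uIoc_of_le h.cut_lt_right.le]
    exact fun p hp => (hzero (Ioc_subset_Icc_self hp)).symm
  refine ⟨hFl.trans hFr, ?_⟩
  have hr : ∫ p in (p2 - η)..p2, F p = 0 := by
    rw [intervalIntegral.integral_congr (g := 0)]
    · simp
    · rw [uIcc_of_le h.cut_lt_right.le]
      exact hzero
  rw [← intervalIntegral.integral_add_adjacent_intervals hFl hFr, hr, add_zero,
    ← intervalIntegral.integral_const_mul, intervalIntegral.integral_of_le h.left_lt_cut.le,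
    intervalIntegral.integral_of_le hS.le, integral_Ioc_eq_integral_Ioo,
    integral_Ioc_eq_integral_Ioo, ← h.image_inv,
    integral_image_eq_integral_abs_deriv_smul measurableSet_Ioo
      (fun s hs => h.hasDerivWithinAt_inv hs) hinj]
  exact setIntegral_congr_fun measurableSet_Ioo hpull

/-- The contribution of the endpoint `p1`, with `σ` the sign of the phase. -/
theorem integral_cutoff_expansion (h : IsEndpointChart p1 p2 η ρ S N ψ φ g)
    (hν : IsCutoff p1 p2 η ν) (hσ : σ = 1 ∨ σ = -1) (hω : 0 < ω) (hμ : μ ∈ Ioc (0 : ℝ) 1)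
    (hk : ContDiffOn ℝ N k (Icc 0 S))
    (hkU : ∀ s ∈ Ioc 0 S, k s = U (g s) * ((s ^ (1 - μ) : ℝ) : ℂ) *
      ((derivWithin g (Icc 0 S) s : ℝ) : ℂ)) :
    ∫ p in p1..p2, ((ν p : ℝ) : ℂ) *
        (U p * Complex.exp (Complex.I * ((σ * ω * ψ p : ℝ) : ℂ))) =
      Complex.exp (Complex.I * ((σ * ω * ψ p1 : ℝ) : ℂ)) *
        ((σ : ℂ) * ∑ n ∈ Finset.range N, theta σ ρ μ n * iteratedDerivWithin n k (Icc 0 S) 0 *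
            ((ω ^ (-(((n : ℝ) + μ) / ρ)) : ℝ) : ℂ) +
          (-1) ^ N * ∫ s in (0 : ℝ)..S, phiN σ ρ μ N s ω *
            iteratedDerivWithin N (fun s : ℝ => ((ν (g s) : ℝ) : ℂ) * k s) (Icc 0 S) s) := by
  rw [(h.intervalIntegrable_and_integral_cutoff hν hσ hω hμ hk hkU).2,
    integral_power_phase_expansion hσ hω h.one_le_exponent hμ h.end_pos h.one_le_order
      (h.contDiffOn_cutoff_mul hν hk)
      (fun n hn => h.iteratedDerivWithin_cutoff_mul_end hν hk hn.le)]
  simp only [h.iteratedDerivWithin_cutoff_mul_zero hν]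

end IsEndpointChart

lemma norm_integral_phiN_le {σ ω ρ S a b c K γ : ℝ} {N : ℕ} {f : ℝ → ℂ}
    (hσ : σ = 1 ∨ σ = -1) (hω : 0 < ω) (hρ : 2 ≤ ρ) (hS : 0 < S) (hN : 1 ≤ N)
    (hf : ContDiffOn ℝ N f (Icc 0 S)) (hγ : γ ∈ Ioo (0 : ℝ) 1)
    (ha : a = Real.Gamma ((N : ℝ) / ρ) / ((Nat.factorial (N - 1) : ℝ) * ρ))
    (hb : b = if N = 1 then 1 / ρ
      else Real.Gamma (((N : ℝ) - 1) / ρ) / (ρ ^ 2 * (Nat.factorial (N - 2) : ℝ)))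
    (hc : c = if N = 1 then (ρ - 1) * Real.Gamma (1 / ρ) / ρ ^ 2
      else (ρ - 1) * Real.Gamma ((N : ℝ) / ρ) / (ρ ^ 2 * (Nat.factorial (N - 1) : ℝ)))
    (hK : 0 < K) (hroot : a * K ^ ρ - b * K - c = 0) :
    ‖∫ s in (0 : ℝ)..S, phiN σ ρ 1 N s ω * iteratedDerivWithin N f (Icc 0 S) s‖ ≤
      (a * K ^ γ) * (∫ s in (0 : ℝ)..S, s ^ (-γ) * ‖iteratedDerivWithin N f (Icc 0 S) s‖) *
        ω ^ (-((γ + (N : ℝ)) / ρ)) := by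
  have hcont : ContinuousOn (fun s => ‖iteratedDerivWithin N f (Icc 0 S) s‖) (uIcc 0 S) := by
    rw [uIcc_of_le hS.le]
    exact (hf.continuousOn_iteratedDerivWithin le_rfl (uniqueDiffOn_Icc hS)).norm
  have h_int : IntervalIntegrable (fun s : ℝ => s ^ (-γ) * ‖iteratedDerivWithin N f (Icc 0 S) s‖)
      volume 0 S :=
    (intervalIntegral.intervalIntegrable_rpow' (by linarith [hγ.2])).mul_continuousOn hcont
  have hrw : (a * K ^ γ) *
        (∫ s in (0 : ℝ)..S, s ^ (-γ) * ‖iteratedDerivWithin N f (Icc 0 S) s‖) *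
        ω ^ (-((γ + (N : ℝ)) / ρ)) =
      ∫ s in (0 : ℝ)..S, (a * K ^ γ * ω ^ (-((γ + (N : ℝ)) / ρ))) *
        (s ^ (-γ) * ‖iteratedDerivWithin N f (Icc 0 S) s‖) := by
    rw [intervalIntegral.integral_const_mul]
    ring
  rw [hrw]
  refine intervalIntegral.norm_integral_le_of_norm_le hS.le ?_ (h_int.const_mul _)
  filter_upwards with s hs
  rw [norm_mul]
  refine (mul_le_mul_of_nonneg_right (norm_phiN_le_interpolated hσ hω hρ hs.1 hN hγ ha hb hc hK
    hroot) (norm_nonneg _)).trans_eq ?_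
  ring

lemma contDiffOn_and_deriv_pos_of_derivWithin_eq {p1 p2 ρ1 ρ2 : ℝ} {N : ℕ} {ψ ψt : ℝ → ℝ}
    (hψC1 : ContDiffOn ℝ 1 ψ (Icc p1 p2)) (hψtC : ContDiffOn ℝ N ψt (Icc p1 p2))
    (hψtpos : ∀ p ∈ Icc p1 p2, 0 < ψt p)
    (hψd : ∀ p ∈ Icc p1 p2,
      derivWithin ψ (Icc p1 p2) p = (p - p1) ^ (ρ1 - 1) * (p2 - p) ^ (ρ2 - 1) * ψt p) :
    ContDiffOn ℝ N ψ (Ioo p1 p2) ∧ ∀ p ∈ Ioo p1 p2, 0 < deriv ψ p := by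
  have hd : ∀ p ∈ Ioo p1 p2, deriv ψ p = (p - p1) ^ (ρ1 - 1) * (p2 - p) ^ (ρ2 - 1) * ψt p := by
    intro p hp
    rw [← hψd p (Ioo_subset_Icc_self hp), derivWithin_of_mem_nhds (Icc_mem_nhds hp.1 hp.2)]
  refine ⟨?_, fun p hp => ?_⟩
  · have hdC : ContDiffOn ℝ N (deriv ψ) (Ioo p1 p2) := by
      refine ContDiffOn.congr (fun p hp => ?_) hd
      refine ContDiffWithinAt.mul (ContDiffWithinAt.mul ?_ ?_)
        ((hψtC.mono Ioo_subset_Icc_self) p hp)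
      · exact (contDiffWithinAt_id.sub contDiffWithinAt_const).rpow_const_of_ne
          (sub_pos.2 hp.1).ne'
      · exact (contDiffWithinAt_const.sub contDiffWithinAt_id).rpow_const_of_ne
          (sub_pos.2 hp.2).ne'
    have hsucc : ContDiffOn ℝ (N + 1) ψ (Ioo p1 p2) := by
      rw [contDiffOn_succ_iff_deriv_of_isOpen isOpen_Ioo]
      exact ⟨(hψC1.differentiableOn one_ne_zero).mono Ioo_subset_Icc_self, by simp, hdC⟩
    exact hsucc.of_le le_self_add
  · rw [hd p hp]
    exact mul_pos (mul_pos (Real.rpow_pos_of_pos (sub_pos.2 hp.1) _)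
      (Real.rpow_pos_of_pos (sub_pos.2 hp.2) _)) (hψtpos p (Ioo_subset_Icc_self hp))

/-- The chart at the right endpoint, read after the reflection `p ↦ -p`. -/
lemma isEndpointChart_reflect {p1 p2 η ρ S : ℝ} {N : ℕ} {ψ φ g : ℝ → ℝ} (hN : 1 ≤ N)
    (hp : p1 < p2) (hη : η ∈ Ioo (0 : ℝ) ((p2 - p1) / 2)) (hρ : 1 ≤ ρ)
    (hψ : ContinuousOn ψ (Icc p1 p2)) (hψC : ContDiffOn ℝ N ψ (Ioo p1 p2))
    (hψpos : ∀ p ∈ Ioo p1 p2, 0 < deriv ψ p)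
    (hφ : ∀ p ∈ Icc (p1 + η) p2, φ p = (ψ p2 - ψ p) ^ (1 / ρ)) (hS : S = φ (p1 + η))
    (hgl : ∀ p ∈ Icc (p1 + η) p2, g (φ p) = p) (hgr : ∀ s ∈ Icc 0 S, φ (g s) = s)
    (hgm : ∀ s ∈ Icc 0 S, g s ∈ Icc (p1 + η) p2) :
    IsEndpointChart (-p2) (-p1) η ρ S N (fun p => -ψ (-p)) (fun p => φ (-p)) (fun s => -g s) where
  one_le_order := hN
  lt := neg_lt_neg hp
  cut_mem := ⟨hη.1, by linarith [hη.2]⟩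
  one_le_exponent := hρ
  continuousOn := (hψ.comp continuousOn_neg fun p hp => ⟨by linarith [hp.2], by linarith [hp.1]⟩).neg
  contDiffOn := (hψC.comp contDiff_neg.contDiffOn
    fun p hp => ⟨by linarith [hp.2], by linarith [hp.1]⟩).neg
  deriv_pos := fun p hp => by
    rw [deriv.fun_neg, deriv_comp_neg, neg_neg]
    exact hψpos _ ⟨by linarith [hp.2], by linarith [hp.1]⟩
  chart_eq := fun p hp => by
    rw [hφ _ ⟨by linarith [hp.2], by linarith [hp.1]⟩, neg_neg]
    ring_nf
  end_eq := by
    rw [hS]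
    congr 1
    ring
  left_inv := fun p hp => by
    rw [hgl _ ⟨by linarith [hp.2], by linarith [hp.1]⟩, neg_neg]
  right_inv := fun s hs => by rw [neg_neg, hgr s hs]
  mapsTo := fun s hs => ⟨by linarith [(hgm s hs).2], by linarith [(hgm s hs).1]⟩

lemma IsCutoff.reflect {p1 p2 η : ℝ} {ν : ℝ → ℝ} (hν : IsCutoff p1 p2 η ν) :
    IsCutoff (-p2) (-p1) η (fun p => 1 - ν (-p)) where
  contDiff := contDiff_const.sub (hν.contDiff.comp contDiff_neg)
  eq_one := fun p hp => by
    rw [hν.eq_zero _ ⟨by linarith [hp.2], by linarith [hp.1]⟩, sub_zero]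
  eq_zero := fun p hp => by
    rw [hν.eq_one _ ⟨by linarith [hp.2], by linarith [hp.1]⟩, sub_self]

/-- Theorem 1.6: refinement of Erdélyi's error estimate when the amplitude is regular at
`p_j` (`μ_j = 1`) and `ρ_j ≥ 2`.  The decomposition of Theorem 1.3 still holds and, for any
`γ ∈ (0,1)`, with `δ := (γ+N)/ρ_j` and `L_{γ,ρ_j,N} = a K^γ` (where `K` is the unique
positive root of `aK^{ρ_j} − bK − c = 0`, `a,b,c` being the explicit constants of the two
estimates of `φ_N^{(j)}(·,·,ρ_j,1)`), one has
`|R_N^{(j)}(ω)| ≤ L_{γ,ρ_j,N} (∫_0^{s_j} s^{−γ} |(ν_j k_j)^{(N)}(s)| ds) ω^{−δ}`. -/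
theorem stmt3 (p1 p2 ρ1 ρ2 μ1 μ2 η s1 s2 : ℝ) (N : ℕ)
    (ψ ψt : ℝ → ℝ) (U ut : ℝ → ℂ) (φ1 φ2 g1 g2 ν : ℝ → ℝ) (k1 k2 : ℝ → ℂ)
    (hp : p1 < p2) (hN : 1 ≤ N)
    (hρ1 : 1 ≤ ρ1) (hρ2 : 1 ≤ ρ2)
    (hμ1 : μ1 ∈ Set.Ioc (0 : ℝ) 1) (hμ2 : μ2 ∈ Set.Ioc (0 : ℝ) 1)
    -- Assumption (P_{ρ1,ρ2,N})
    (hψC1 : ContDiffOn ℝ 1 ψ (Set.Icc p1 p2))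
    (hψtC : ContDiffOn ℝ N ψt (Set.Icc p1 p2))
    (hψtpos : ∀ p ∈ Set.Icc p1 p2, 0 < ψt p)
    (hψd : ∀ p ∈ Set.Icc p1 p2,
      derivWithin ψ (Set.Icc p1 p2) p = (p - p1) ^ (ρ1 - 1) * (p2 - p) ^ (ρ2 - 1) * ψt p)
    -- Assumption (A_{μ1,μ2,N})
    (hutC : ContDiffOn ℝ N ut (Set.Icc p1 p2))
    (hU : ∀ p ∈ Set.Ioo p1 p2,
      U p = (((p - p1) ^ (μ1 - 1) * (p2 - p) ^ (μ2 - 1) : ℝ) : ℂ) * ut p)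
    (hut1 : μ1 ≠ 1 → ut p1 ≠ 0) (hut2 : μ2 ≠ 1 → ut p2 ≠ 0)
    -- the distinguished index j with μ_j = 1 and ρ_j ≥ 2
    (j : ℕ) (hj : j = 1 ∨ j = 2)
    (hμj : (if j = 1 then μ1 else μ2) = 1)
    (hρj : 2 ≤ (if j = 1 then ρ1 else ρ2))
    -- the cut and the substitutions φ1, φ2 with inverses g1, g2
    (hη : η ∈ Set.Ioo (0 : ℝ) ((p2 - p1) / 2))
    (hφ1 : ∀ p ∈ Set.Icc p1 (p2 - η), φ1 p = (ψ p - ψ p1) ^ (1 / ρ1))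
    (hφ2 : ∀ p ∈ Set.Icc (p1 + η) p2, φ2 p = (ψ p2 - ψ p) ^ (1 / ρ2))
    (hs1 : s1 = φ1 (p2 - η)) (hs2 : s2 = φ2 (p1 + η))
    (hg1l : ∀ p ∈ Set.Icc p1 (p2 - η), g1 (φ1 p) = p)
    (hg1r : ∀ s ∈ Set.Icc 0 s1, φ1 (g1 s) = s)
    (hg1m : ∀ s ∈ Set.Icc 0 s1, g1 s ∈ Set.Icc p1 (p2 - η))
    (hg2l : ∀ p ∈ Set.Icc (p1 + η) p2, g2 (φ2 p) = p)
    (hg2r : ∀ s ∈ Set.Icc 0 s2, φ2 (g2 s) = s)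
    (hg2m : ∀ s ∈ Set.Icc 0 s2, g2 s ∈ Set.Icc (p1 + η) p2)
    -- the functions k1, k2
    (hk1C : ContDiffOn ℝ N k1 (Set.Icc 0 s1))
    (hk2C : ContDiffOn ℝ N k2 (Set.Icc 0 s2))
    (hk1 : ∀ s ∈ Set.Ioc 0 s1,
      k1 s = U (g1 s) * ((s ^ (1 - μ1) : ℝ) : ℂ) * ((derivWithin g1 (Set.Icc 0 s1) s : ℝ) : ℂ))
    (hk2 : ∀ s ∈ Set.Ioc 0 s2,
      k2 s = U (g2 s) * ((s ^ (1 - μ2) : ℝ) : ℂ) * ((derivWithin g2 (Set.Icc 0 s2) s : ℝ) : ℂ))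
    -- the smooth cut-off ν
    (hνC : ContDiff ℝ (⊤ : ℕ∞) ν)
    (hν1 : ∀ p ∈ Set.Icc p1 (p1 + η), ν p = 1)
    (hν0 : ∀ p ∈ Set.Icc (p2 - η) p2, ν p = 0)
    (hνb : ∀ p : ℝ, ν p ∈ Set.Icc (0 : ℝ) 1)
    (ω : ℝ) (hω : 0 < ω)
    -- the main terms and remainders of Theorem 1.3
    (A1 A2 R1 R2 : ℂ)
    (hA1 : A1 = Complex.exp (Complex.I * ((ω * ψ p1 : ℝ) : ℂ)) *
      ∑ n ∈ Finset.range N, theta 1 ρ1 μ1 n * iteratedDerivWithin n k1 (Set.Icc 0 s1) 0 *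
        ((ω ^ (-(((n : ℝ) + μ1) / ρ1)) : ℝ) : ℂ))
    (hA2 : A2 = Complex.exp (Complex.I * ((ω * ψ p2 : ℝ) : ℂ)) *
      ∑ n ∈ Finset.range N, theta (-1) ρ2 μ2 n * iteratedDerivWithin n k2 (Set.Icc 0 s2) 0 *
        ((ω ^ (-(((n : ℝ) + μ2) / ρ2)) : ℝ) : ℂ))
    (hR1 : R1 = (-1 : ℂ) ^ (N + 1 + 1) * Complex.exp (Complex.I * ((ω * ψ p1 : ℝ) : ℂ)) *
      ∫ s in (0 : ℝ)..s1, phiN 1 ρ1 μ1 N s ω *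
        iteratedDerivWithin N (fun s : ℝ => ((ν (g1 s) : ℝ) : ℂ) * k1 s) (Set.Icc 0 s1) s)
    (hR2 : R2 = (-1 : ℂ) ^ (N + 1 + 2) * Complex.exp (Complex.I * ((ω * ψ p2 : ℝ) : ℂ)) *
      ∫ s in (0 : ℝ)..s2, phiN (-1) ρ2 μ2 N s ω *
        iteratedDerivWithin N (fun s : ℝ => ((1 - ν (g2 s) : ℝ) : ℂ) * k2 s) (Set.Icc 0 s2) s)
    -- data attached to the distinguished index j
    (ρj sj : ℝ) (Rj : ℂ) (hfun : ℝ → ℂ) (a b cc : ℝ)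
    (hρjdef : ρj = if j = 1 then ρ1 else ρ2)
    (hsj : sj = if j = 1 then s1 else s2)
    (hRj : Rj = if j = 1 then R1 else R2)
    (hhfun : hfun = if j = 1 then (fun s : ℝ => ((ν (g1 s) : ℝ) : ℂ) * k1 s)
      else (fun s : ℝ => ((1 - ν (g2 s) : ℝ) : ℂ) * k2 s))
    (ha : a = Real.Gamma ((N : ℝ) / ρj) / ((Nat.factorial (N - 1) : ℝ) * ρj))
    (hb : b = if N = 1 then 1 / ρj
      else Real.Gamma (((N : ℝ) - 1) / ρj) / (ρj ^ 2 * (Nat.factorial (N - 2) : ℝ)))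
    (hcc : cc = if N = 1 then (ρj - 1) * Real.Gamma (1 / ρj) / ρj ^ 2
      else (ρj - 1) * Real.Gamma ((N : ℝ) / ρj) / (ρj ^ 2 * (Nat.factorial (N - 1) : ℝ))) :
    (∫ p in p1..p2, U p * Complex.exp (Complex.I * ((ω * ψ p : ℝ) : ℂ))) =
        (A1 + R1) + (A2 + R2) ∧
    ∀ γ ∈ Set.Ioo (0 : ℝ) 1, ∀ K : ℝ, 0 < K → a * K ^ ρj - b * K - cc = 0 →
      ‖Rj‖ ≤ (a * K ^ γ) *
          (∫ s in (0 : ℝ)..sj, s ^ (-γ) *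
            ‖iteratedDerivWithin N hfun (Set.Icc 0 (if j = 1 then s1 else s2)) s‖) *
          ω ^ (-((γ + (N : ℝ)) / ρj)) := by
  obtain ⟨hψC, hψpos⟩ := contDiffOn_and_deriv_pos_of_derivWithin_eq hψC1 hψtC hψtpos hψd
  have hν : IsCutoff p1 p2 η ν := ⟨hνC, hν1, hν0⟩
  have hc1 : IsEndpointChart p1 p2 η ρ1 s1 N ψ φ1 g1 :=
    ⟨hN, hp, hη, hρ1, hψC1.continuousOn, hψC, hψpos, hφ1, hs1, hg1l, hg1r, hg1m⟩
  have hc2 := isEndpointChart_reflect hN hp hη hρ2 hψC1.continuousOn hψC hψpos hφ2 hs2 hg2l hg2r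
    hg2m
  have hk2' : ∀ s ∈ Ioc 0 s2, -k2 s = U (-(-g2 s)) * ((s ^ (1 - μ2) : ℝ) : ℂ) *
      ((derivWithin (fun s => -g2 s) (Icc 0 s2) s : ℝ) : ℂ) := by
    intro s hs
    rw [hk2 s hs, derivWithin.fun_neg, neg_neg, Complex.ofReal_neg, mul_neg]
  have hk2N : ContDiffOn ℝ N (fun s => -k2 s) (Icc 0 s2) := hk2C.neg
  refine ⟨?_, ?_⟩
  · have hi1 := (hc1.intervalIntegrable_and_integral_cutoff hν (Or.inl rfl) hω hμ1 hk1C hk1).1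
    have he1 := hc1.integral_cutoff_expansion hν (Or.inl rfl) hω hμ1 hk1C hk1
    have hi2 := (hc2.intervalIntegrable_and_integral_cutoff (U := fun p => U (-p)) hν.reflect
      (Or.inr rfl) hω hμ2 hk2N hk2').1
    have he2 := hc2.integral_cutoff_expansion (U := fun p => U (-p)) hν.reflect
      (Or.inr rfl) hω hμ2 hk2N hk2'
    set F2 : ℝ → ℂ := fun p => ((1 - ν p : ℝ) : ℂ) *
      (U p * Complex.exp (Complex.I * ((ω * ψ p : ℝ) : ℂ))) with hF2
    have hF2' : (fun p => ((1 - ν (-p) : ℝ) : ℂ) *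
        (U (-p) * Complex.exp (Complex.I * ((-1 * ω * -ψ (-p) : ℝ) : ℂ)))) = fun p => F2 (-p) := by
      funext p
      simp [hF2]
    rw [hF2'] at hi2 he2
    rw [intervalIntegral.integral_comp_neg, neg_neg, neg_neg] at he2
    rw [IntervalIntegrable.iff_comp_neg] at hi2
    simp only [neg_neg] at hi2 he2
    have hsum : ∀ p, U p * Complex.exp (Complex.I * ((ω * ψ p : ℝ) : ℂ)) =
        ((ν p : ℝ) : ℂ) * (U p * Complex.exp (Complex.I * ((1 * ω * ψ p : ℝ) : ℂ))) + F2 p := by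
      intro p
      simp only [hF2, one_mul]
      push_cast
      ring
    rw [intervalIntegral.integral_congr fun p _ => hsum p,
      intervalIntegral.integral_add hi1 hi2.symm, he1, he2, hA1, hA2, hR1, hR2]
    simp only [mul_neg, iteratedDerivWithin_fun_neg, neg_mul, Finset.sum_neg_distrib,
      intervalIntegral.integral_neg, one_mul, neg_neg, Complex.ofReal_one, Complex.ofReal_neg]
    ring
  · intro γ hγ K hK hroot
    rcases hj with rfl | rfl
    · simp only [if_true] at hμj hρj hρjdef hsj hRj hhfun ⊢
      subst hμj hρjdef hsj hRj hhfun
      rw [hR1, norm_mul, norm_mul, norm_pow, norm_neg, norm_one, one_pow, one_mul, mul_comm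
        Complex.I, Complex.norm_exp_ofReal_mul_I, one_mul]
      exact norm_integral_phiN_le (Or.inl rfl) hω hρj hc1.end_pos hN
        (hc1.contDiffOn_cutoff_mul hν hk1C) hγ ha hb hcc hK hroot
    · simp only [OfNat.ofNat_ne_one, if_false] at hμj hρj hρjdef hsj hRj hhfun ⊢
      subst hμj hρjdef hsj hRj hhfun
      have hreg : ContDiffOn ℝ N (fun s : ℝ => ((1 - ν (g2 s) : ℝ) : ℂ) * k2 s) (Icc 0 sj) := by
        simpa using (hc2.contDiffOn_cutoff_mul hν.reflect hk2C)
      rw [hR2, norm_mul, norm_mul, norm_pow, norm_neg, norm_one, one_pow, one_mul, mul_comm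
        Complex.I, Complex.norm_exp_ofReal_mul_I, one_mul]
      exact norm_integral_phiN_le (Or.inr rfl) hω hρj hc2.end_pos hN hreg hγ ha hb hcc hK hroot
end

section
/- Fix q1, q2 ∈ (p1,p2) and let ψ : [p1,p2] → ℝ satisfy Assumption (P_{ρ1,ρ2,N}) for some ρ1, ρ2 ≥ 1 and N ∈ ℕ∖{0}. Define φ1(p) := (ψ(p)−ψ(p1))^{1/ρ1} for p ∈ [p1,q1] and φ2(p) := (ψ(p2)−ψ(p))^{1/ρ2} for p ∈ [q2,p2]. Then φ1 is a C^{N+1}-diffeomorphism from [p1,q1] onto [0,φ1(q1)], and φ2 is a C^{N+1}-diffeomorphism from [q2,p2] onto [0,φ2(q2)]. -/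
open Set

/-- A `C^n` function on a compact interval extends to a `C^n` function on the real line. -/
theorem exists_contDiff_eqOn_Icc {a b : ℝ} (hab : a < b) (n : ℕ) :
    ∀ {f : ℝ → ℝ}, ContDiffOn ℝ n f (Icc a b) →
      ∃ g : ℝ → ℝ, ContDiff ℝ n g ∧ EqOn g f (Icc a b) := by
  induction n with
  | zero =>
    intro f hf
    refine ⟨IccExtend hab.le ((Icc a b).domRestrict f), ?_, fun x hx =>
      IccExtend_of_mem hab.le _ hx⟩
    have hc : ContinuousOn f (Icc a b) := hf.continuousOn
    exact contDiff_zero.2 (hc.domRestrict.Icc_extend' (h := hab.le))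
  | succ n ih =>
    intro f hf
    have hu : UniqueDiffOn ℝ (Icc a b) := uniqueDiffOn_Icc hab
    push_cast at hf ⊢
    obtain ⟨hd, -, hf'⟩ := (contDiffOn_succ_iff_derivWithin hu).1 hf
    obtain ⟨k, hk, hkf⟩ := ih hf'
    have hderiv : ∀ x, HasDerivAt (fun x => f a + ∫ t in a..x, k t) (k x) x := fun x =>
      ((hk.continuous.integral_hasStrictDerivAt a x).hasDerivAt).const_add (f a)
    refine ⟨fun x => f a + ∫ t in a..x, k t, ?_, fun x hx => ?_⟩
    · refine contDiff_succ_iff_deriv.2 ⟨fun x => (hderiv x).differentiableAt, by simp, ?_⟩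
      rwa [show deriv (fun x => f a + ∫ t in a..x, k t) = k from funext fun x => (hderiv x).deriv]
    · have := intervalIntegral.integral_eq_sub_of_hasDerivAt_of_le (f := f) (f' := k) hx.1
        (hd.continuousOn.mono (Icc_subset_Icc_right hx.2)) (fun y hy => by
          have hy' : y ∈ Icc a b := ⟨hy.1.le, hy.2.le.trans hx.2⟩
          rw [hkf hy']
          exact (hd y hy').hasDerivWithinAt.hasDerivAt
            (Icc_mem_nhds hy.1 (hy.2.trans_le hx.2)))
        (hk.continuous.intervalIntegrable _ _)
      simp only [this]
      ring

/-- A `C^{n+1}` function with positive derivative on a compact interval is a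
`C^{n+1}`-diffeomorphism onto its image. -/
theorem exists_contDiffOn_inverse_of_deriv_pos {a b : ℝ} (hab : a < b) (n : ℕ) {f f' : ℝ → ℝ}
    (hf : ContDiffOn ℝ (n + 1) f (Icc a b))
    (hd : ∀ x ∈ Icc a b, HasDerivWithinAt f (f' x) (Icc a b) x)
    (hpos : ∀ x ∈ Icc a b, 0 < f' x) :
    BijOn f (Icc a b) (Icc (f a) (f b)) ∧
      ∃ g : ℝ → ℝ, ContDiffOn ℝ (n + 1) g (Icc (f a) (f b)) ∧
        (∀ x ∈ Icc a b, g (f x) = x) ∧ ∀ s ∈ Icc (f a) (f b), f (g s) = s := by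
  have hcont : ContinuousOn f (Icc a b) := hf.continuousOn
  have hmono : StrictMonoOn f (Icc a b) := by
    refine strictMonoOn_of_hasDerivWithinAt_pos (f' := f') (convex_Icc a b) hcont ?_ ?_
    · exact fun x hx => (hd x (interior_subset hx)).mono interior_subset
    · exact fun x hx => hpos x (interior_subset hx)
  have ha : a ∈ Icc a b := left_mem_Icc.2 hab.le
  have hb : b ∈ Icc a b := right_mem_Icc.2 hab.le
  have hle : f a ≤ f b := (hmono ha hb hab).le
  have hbij : BijOn f (Icc a b) (Icc (f a) (f b)) :=
    ⟨fun x hx => ⟨hmono.monotoneOn ha hx hx.1, hmono.monotoneOn hx hb hx.2⟩, hmono.injOn,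
      intermediate_value_Icc hab.le hcont⟩
  refine ⟨hbij, ?_⟩
  let F : Icc a b → Icc (f a) (f b) := hbij.mapsTo.restrict f _ _
  have hFmono : StrictMono F := fun x y hxy => hmono x.2 y.2 hxy
  have hFsurj : Function.Surjective F := fun s => by
    obtain ⟨x, hx, hxs⟩ := hbij.surjOn s.2
    exact ⟨⟨x, hx⟩, Subtype.ext hxs⟩
  let e := hFmono.orderIsoOfSurjective F hFsurj
  let g : ℝ → ℝ := fun s => e.symm (projIcc (f a) (f b) hle s)
  have hgcont : Continuous g :=
    continuous_subtype_val.comp (e.symm.continuous.comp continuous_projIcc)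
  have hgmem : ∀ s, g s ∈ Icc a b := fun s => (e.symm _).2
  have hfg : ∀ s ∈ Icc (f a) (f b), f (g s) = s := fun s hs => by
    have : (F (e.symm (projIcc (f a) (f b) hle s)) : ℝ) = projIcc (f a) (f b) hle s :=
      congrArg Subtype.val (e.apply_symm_apply _)
    rw [projIcc_of_mem hle hs] at this
    simp only [g, projIcc_of_mem hle hs]
    exact this
  have hgf : ∀ x ∈ Icc a b, g (f x) = x := fun x hx =>
    hmono.injOn (hgmem _) hx (hfg _ (hbij.mapsTo hx))
  refine ⟨g, fun s hs => ?_, hgf, hfg⟩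
  obtain ⟨Φ, hΦ, hΦf⟩ := exists_contDiff_eqOn_Icc hab (n + 1) (f := f) (by exact_mod_cast hf)
  have hn : ((n + 1 : ℕ) : WithTop ℕ∞) ≠ 0 := by exact_mod_cast n.succ_ne_zero
  have hx := hgmem s
  have hΦd : HasDerivAt Φ (f' (g s)) (g s) := by
    have h1 : HasDerivAt Φ (deriv Φ (g s)) (g s) := (hΦ.differentiable hn _).hasDerivAt
    have h2 := (hd _ hx).congr hΦf (hΦf hx)
    rwa [(uniqueDiffOn_Icc hab _ hx).eq_deriv _ h1.hasDerivWithinAt h2] at h1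
  have hΦfd := hΦd.hasFDerivAt_equiv (hpos _ hx).ne'
  have hΦs := hΦ.contDiffAt.hasStrictFDerivAt' hΦfd hn
  have hinv := hΦ.contDiffAt.to_localInverse hΦfd hn
  rw [hΦf hx, hfg s hs] at hinv
  have hev := (hgcont.tendsto s).eventually hΦs.eventually_left_inverse
  have heq : ∀ᶠ t in nhds s, t ∈ Icc (f a) (f b) →
      g t = hΦ.contDiffAt.localInverse hΦfd hn t := by
    filter_upwards [hev] with t ht hts
    rw [hΦf (hgmem t), hfg t hts] at ht
    exact ht.symm
  have := (hinv.contDiffWithinAt (s := Icc (f a) (f b))).congr_of_eventuallyEq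
    (eventually_nhdsWithin_iff.2 heq) (heq.self_of_nhds hs)
  exact_mod_cast this

/-- Differentiation under the integral sign for weighted averages over dilations. -/
theorem hasDerivAt_integral_mul_comp_mul {w h h' : ℝ → ℝ} (hw : Continuous w)
    (hh : ∀ x, HasDerivAt h (h' x) x) (hh' : Continuous h') (x : ℝ) :
    HasDerivAt (fun x => ∫ y in (0 : ℝ)..1, w y * h (y * x))
      (∫ y in (0 : ℝ)..1, (w y * y) * h' (y * x)) x := by
  have hc : Continuous h := continuous_iff_continuousAt.2 fun x => (hh x).continuousAt
  obtain ⟨C, hC⟩ := (isCompact_Icc.prod (isCompact_closedBall x 1)).exists_bound_of_continuousOn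
    (f := fun q : ℝ × ℝ => (w q.1 * q.1) * h' (q.1 * q.2)) (s := Icc (0 : ℝ) 1 ×ˢ _)
    (by fun_prop)
  refine (intervalIntegral.hasDerivAt_integral_of_dominated_loc_of_deriv_le
    (F := fun x y => w y * h (y * x)) (F' := fun x y => (w y * y) * h' (y * x))
    (bound := fun _ => C) (Metric.closedBall_mem_nhds x one_pos) ?_ ?_ ?_ ?_ ?_ ?_).2
  · exact .of_forall fun z => (by fun_prop : Continuous _).aestronglyMeasurable
  · exact (by fun_prop : Continuous _).intervalIntegrable _ _
  · exact (by fun_prop : Continuous _).aestronglyMeasurable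
  · refine .of_forall fun y hy z hz => hC (y, z) ⟨?_, hz⟩
    rw [uIoc_of_le zero_le_one] at hy
    exact ⟨hy.1.le, hy.2⟩
  · exact continuous_const.intervalIntegrable _ _
  · refine .of_forall fun y _ z _ => ?_
    have := ((hh (y * z)).comp z ((hasDerivAt_id z).const_mul y)).const_mul (w y)
    exact this.congr_deriv (by simp; ring)

/-- Weighted averages over dilations of a `C^n` function are `C^n`. -/
theorem contDiff_integral_mul_comp_mul (n : ℕ) : ∀ {w h : ℝ → ℝ}, Continuous w →
    ContDiff ℝ n h → ContDiff ℝ n fun x => ∫ y in (0 : ℝ)..1, w y * h (y * x) := by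
  induction n with
  | zero =>
    intro w h hw hh
    have hc : Continuous h := hh.continuous
    exact contDiff_zero.2 (
      intervalIntegral.continuous_parametric_intervalIntegral_of_continuous'
      (μ := MeasureTheory.volume) (f := fun x y => w y * h (y * x)) (by fun_prop) 0 1)
  | succ n ih =>
    intro w h hw hh
    push_cast at hh ⊢
    obtain ⟨hd, -, hh'⟩ := contDiff_succ_iff_deriv.1 hh
    have hderiv := hasDerivAt_integral_mul_comp_mul hw (fun x => (hd x).hasDerivAt) hh'.continuous
    refine contDiff_succ_iff_deriv.2 ⟨fun x => (hderiv x).differentiableAt, by simp, ?_⟩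
    rw [funext fun x => (hderiv x).deriv]
    exact ih (by fun_prop) hh'

/-- If `ψ' = x^{ρ-1} h` with `h` positive and of class `C^n` on `[0,b]`, then `(ψ - ψ 0)^{1/ρ}` is a
`C^{n+1}`-diffeomorphism from `[0,b]` onto its image. -/
theorem rpow_inv_diffeomorphism_of_deriv_eq {b ρ : ℝ} (hb : 0 < b) (hρ : 1 ≤ ρ) (n : ℕ)
    {ψ h : ℝ → ℝ} (hh : ContDiffOn ℝ n h (Icc 0 b)) (hpos : ∀ x ∈ Icc 0 b, 0 < h x)
    (hψ : ∀ x ∈ Icc 0 b, HasDerivWithinAt ψ (x ^ (ρ - 1) * h x) (Icc 0 b) x)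
    {φ : ℝ → ℝ} (hφ : ∀ x ∈ Icc 0 b, φ x = (ψ x - ψ 0) ^ (1 / ρ)) :
    ContDiffOn ℝ (n + 1) φ (Icc 0 b) ∧ BijOn φ (Icc 0 b) (Icc 0 (φ b)) ∧
      ∃ g : ℝ → ℝ, ContDiffOn ℝ (n + 1) g (Icc 0 (φ b)) ∧
        (∀ x ∈ Icc 0 b, g (φ x) = x) ∧ ∀ s ∈ Icc 0 (φ b), φ (g s) = s := by
  have hρ0 : 0 < ρ := by linarith
  have h0 : (0 : ℝ) ∈ Icc 0 b := left_mem_Icc.2 hb.le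
  obtain ⟨H, hH, hHh⟩ := exists_contDiff_eqOn_Icc hb n hh
  have hHc : Continuous H := hH.continuous
  have hw : Continuous fun y : ℝ => y ^ (ρ - 1) := Real.continuous_rpow_const (by linarith)
  set J : ℝ → ℝ := fun x => ∫ y in (0 : ℝ)..1, y ^ (ρ - 1) * H (y * x) with hJdef
  have hJ : ContDiff ℝ n J := contDiff_integral_mul_comp_mul n hw hH
  have hJpos : ∀ x ∈ Icc 0 b, 0 < J x := fun x hx => by
    refine intervalIntegral.intervalIntegral_pos_of_pos_on
      ((by fun_prop : Continuous _).intervalIntegrable _ _) (fun y hy => ?_) one_pos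
    have hyx : y * x ∈ Icc 0 b :=
      ⟨mul_nonneg hy.1.le hx.1, (mul_le_of_le_one_left hx.1 hy.2.le).trans hx.2⟩
    rw [hHh hyx]
    exact mul_pos (Real.rpow_pos_of_pos hy.1 _) (hpos _ hyx)
  have hJ0 : J 0 = h 0 / ρ := by
    simp only [hJdef, mul_zero, intervalIntegral.integral_mul_const, hHh h0]
    rw [integral_rpow (by left; linarith)]
    simp [hρ0.ne', div_eq_inv_mul]
  have hψJ : ∀ x ∈ Icc 0 b, ψ x - ψ 0 = x ^ ρ * J x := fun x hx => by
    rcases hx.1.eq_or_lt with rfl | hx0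
    · simp [hρ0.ne']
    have hftc := intervalIntegral.integral_eq_sub_of_hasDerivAt_of_le (f := ψ)
      (f' := fun t => t ^ (ρ - 1) * H t) hx.1
      (fun y hy => ((hψ y ⟨hy.1, hy.2.trans hx.2⟩).continuousWithinAt.mono
        (Icc_subset_Icc_right hx.2)))
      (fun y hy => by
        have hy' : y ∈ Icc 0 b := ⟨hy.1.le, hy.2.le.trans hx.2⟩
        rw [hHh hy']
        exact (hψ y hy').hasDerivAt (Icc_mem_nhds hy.1 (hy.2.trans_le hx.2)))
      ((by fun_prop : Continuous _).intervalIntegrable _ _)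
    have hsub := intervalIntegral.smul_integral_comp_mul_right (a := 0) (b := 1)
      (fun t => t ^ (ρ - 1) * H t) x
    rw [zero_mul, one_mul, hftc] at hsub
    rw [← hsub, smul_eq_mul]
    have hcongr : ∫ y in (0 : ℝ)..1, (y * x) ^ (ρ - 1) * H (y * x) =
        ∫ y in (0 : ℝ)..1, x ^ (ρ - 1) * (y ^ (ρ - 1) * H (y * x)) := by
      refine intervalIntegral.integral_congr fun y hy => ?_
      rw [uIcc_of_le zero_le_one] at hy
      simp only [Real.mul_rpow hy.1 hx.1]
      ring
    rw [hcongr, intervalIntegral.integral_const_mul, ← mul_assoc]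
    congr 1
    rw [Real.rpow_sub_one hx0.ne']
    field_simp
  have hφJ : ∀ x ∈ Icc 0 b, φ x = x * J x ^ (1 / ρ) := fun x hx => by
    rw [hφ x hx, hψJ x hx, Real.mul_rpow (Real.rpow_nonneg hx.1 _) (hJpos x hx).le,
      ← Real.rpow_mul hx.1, mul_one_div_cancel hρ0.ne', Real.rpow_one]
  have hφ0 : φ 0 = 0 := by simp [hφJ 0 h0]
  set k : ℝ → ℝ := fun x => 1 / ρ * J x ^ (1 / ρ - 1) * h x with hkdef
  have hkpos : ∀ x ∈ Icc 0 b, 0 < k x := fun x hx =>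
    mul_pos (mul_pos (one_div_pos.2 hρ0) (Real.rpow_pos_of_pos (hJpos x hx) _)) (hpos x hx)
  have hk : ContDiffOn ℝ n k (Icc 0 b) :=
    (contDiffOn_const.mul
      (hJ.contDiffOn.rpow_const_of_ne fun x hx => (hJpos x hx).ne')).mul hh
  have hd : ∀ x ∈ Icc 0 b, HasDerivWithinAt φ (k x) (Icc 0 b) x := fun x hx => by
    rcases hx.1.eq_or_lt with rfl | hx0
    · have hk0 : k 0 = J 0 ^ (1 / ρ) := by
        have hJp := hJpos 0 h0
        have : h 0 = ρ * J 0 := by rw [hJ0]; field_simp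
        simp only [hkdef, Real.rpow_sub_one hJp.ne', this]
        field_simp
      rw [hk0, hasDerivWithinAt_iff_tendsto_slope]
      have hlim : Filter.Tendsto (fun x => J x ^ (1 / ρ)) (nhdsWithin 0 (Icc 0 b \ {0}))
          (nhds (J 0 ^ (1 / ρ))) :=
        ((hJ.continuous.continuousAt.rpow_const (.inl (hJpos 0 h0).ne')).tendsto).mono_left
          nhdsWithin_le_nhds
      refine hlim.congr' ?_
      filter_upwards [self_mem_nhdsWithin] with y hy
      have hy0 : y ≠ 0 := hy.2
      rw [slope_def_field, hφ0, hφJ y hy.1]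
      field_simp
      ring
    · have hJp := hJpos x hx
      have hne : ψ x - ψ 0 ≠ 0 := by
        rw [hψJ x hx]
        exact (mul_pos (Real.rpow_pos_of_pos hx0 _) hJp).ne'
      have hder := ((hψ x hx).sub_const (ψ 0)).rpow_const (p := 1 / ρ) (.inl hne)
      refine (hder.congr hφ (hφ x hx)).congr_deriv ?_
      rw [hψJ x hx, Real.mul_rpow (Real.rpow_nonneg hx.1 _) hJp.le, ← Real.rpow_mul hx.1,
        show ρ * (1 / ρ - 1) = -(ρ - 1) by field_simp; ring, Real.rpow_neg hx.1]
      have := (Real.rpow_pos_of_pos hx0 (ρ - 1)).ne'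
      simp only [hkdef]
      field_simp
  have hu := uniqueDiffOn_Icc hb
  have hφC : ContDiffOn ℝ (n + 1) φ (Icc 0 b) :=
    (contDiffOn_succ_iff_derivWithin hu).2 ⟨fun x hx => (hd x hx).differentiableWithinAt, by simp,
      hk.congr fun x hx => (hd x hx).derivWithin (hu x hx)⟩
  have := exists_contDiffOn_inverse_of_deriv_pos hb n hφC hd hkpos
  rw [hφ0] at this
  exact ⟨hφC, this⟩

/-- Being a `C^n`-diffeomorphism is invariant under a `C^n` change of variables in the source. -/
theorem diffeomorphism_of_comp {n : WithTop ℕ∞} {S T R : Set ℝ} {u v φ : ℝ → ℝ}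
    (hu : ContDiff ℝ n u) (hv : ContDiff ℝ n v) (hST : MapsTo u S T) (hTS : MapsTo v T S)
    (hvu : ∀ p ∈ S, v (u p) = p) (huv : ∀ x ∈ T, u (v x) = x)
    (h : ContDiffOn ℝ n (φ ∘ v) T ∧ BijOn (φ ∘ v) T R ∧
      ∃ g : ℝ → ℝ, ContDiffOn ℝ n g R ∧
        (∀ x ∈ T, g ((φ ∘ v) x) = x) ∧ ∀ s ∈ R, (φ ∘ v) (g s) = s) :
    ContDiffOn ℝ n φ S ∧ BijOn φ S R ∧
      ∃ g : ℝ → ℝ, ContDiffOn ℝ n g R ∧ (∀ p ∈ S, g (φ p) = p) ∧ ∀ s ∈ R, φ (g s) = s := by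
  obtain ⟨hC, hB, g, hg, hgl, hgr⟩ := h
  have heq : EqOn ((φ ∘ v) ∘ u) φ S := fun p hp => by simp [hvu p hp]
  have hbu : BijOn u S T := InvOn.bijOn ⟨hvu, huv⟩ hST hTS
  refine ⟨(hC.comp hu.contDiffOn hST).congr heq.symm, (hB.comp hbu).congr heq, v ∘ g,
    hv.comp_contDiffOn hg, fun p hp => ?_, hgr⟩
  have := hgl (u p) (hST hp)
  simp only [Function.comp_apply, hvu p hp] at this
  simp [this, hvu p hp]

/-- Proposition 5.1: under Assumption (P_{ρ1,ρ2,N}), the substitutions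
`φ1(p) = (ψ(p)−ψ(p1))^{1/ρ1}` on `[p1,q1]` and `φ2(p) = (ψ(p2)−ψ(p))^{1/ρ2}` on `[q2,p2]`
are `C^{N+1}`-diffeomorphisms onto `[0,φ1(q1)]` and `[0,φ2(q2)]` respectively
(bijections of class `C^{N+1}` with `C^{N+1}` inverses). -/
theorem stmt17 (p1 p2 q1 q2 ρ1 ρ2 : ℝ) (N : ℕ) (hN : 1 ≤ N)
    (hp : p1 < p2) (hq1 : q1 ∈ Set.Ioo p1 p2) (hq2 : q2 ∈ Set.Ioo p1 p2)
    (hρ1 : 1 ≤ ρ1) (hρ2 : 1 ≤ ρ2)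
    (ψ ψt : ℝ → ℝ)
    (hψC1 : ContDiffOn ℝ 1 ψ (Set.Icc p1 p2))
    (hψtC : ContDiffOn ℝ N ψt (Set.Icc p1 p2))
    (hψtpos : ∀ p ∈ Set.Icc p1 p2, 0 < ψt p)
    (hψd : ∀ p ∈ Set.Icc p1 p2,
      derivWithin ψ (Set.Icc p1 p2) p = (p - p1) ^ (ρ1 - 1) * (p2 - p) ^ (ρ2 - 1) * ψt p)
    (φ1 φ2 : ℝ → ℝ)
    (hφ1 : ∀ p ∈ Set.Icc p1 q1, φ1 p = (ψ p - ψ p1) ^ (1 / ρ1))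
    (hφ2 : ∀ p ∈ Set.Icc q2 p2, φ2 p = (ψ p2 - ψ p) ^ (1 / ρ2)) :
    (ContDiffOn ℝ (N + 1) φ1 (Set.Icc p1 q1) ∧
      Set.BijOn φ1 (Set.Icc p1 q1) (Set.Icc 0 (φ1 q1)) ∧
      ∃ g1 : ℝ → ℝ, ContDiffOn ℝ (N + 1) g1 (Set.Icc 0 (φ1 q1)) ∧
        (∀ p ∈ Set.Icc p1 q1, g1 (φ1 p) = p) ∧
        (∀ s ∈ Set.Icc 0 (φ1 q1), φ1 (g1 s) = s)) ∧
    (ContDiffOn ℝ (N + 1) φ2 (Set.Icc q2 p2) ∧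
      Set.BijOn φ2 (Set.Icc q2 p2) (Set.Icc 0 (φ2 q2)) ∧
      ∃ g2 : ℝ → ℝ, ContDiffOn ℝ (N + 1) g2 (Set.Icc 0 (φ2 q2)) ∧
        (∀ p ∈ Set.Icc q2 p2, g2 (φ2 p) = p) ∧
        (∀ s ∈ Set.Icc 0 (φ2 q2), φ2 (g2 s) = s)) := by
  obtain ⟨hpq1, hqp1⟩ := hq1
  obtain ⟨hpq2, hqp2⟩ := hq2
  have hψ : ∀ p ∈ Icc p1 p2, HasDerivWithinAt ψ
      ((p - p1) ^ (ρ1 - 1) * (p2 - p) ^ (ρ2 - 1) * ψt p) (Icc p1 p2) p := fun p hpI => by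
    rw [← hψd p hpI]
    exact (hψC1.differentiableOn one_ne_zero p hpI).hasDerivWithinAt
  constructor
  · have hmaps : MapsTo (fun x => p1 + x) (Icc 0 (q1 - p1)) (Icc p1 p2) := fun x hx =>
      ⟨by linarith [hx.1], by linarith [hx.2]⟩
    refine diffeomorphism_of_comp (u := fun p => p - p1) (v := fun x => p1 + x)
      (T := Icc 0 (q1 - p1)) (by fun_prop) (by fun_prop)
      (fun p hp' => ⟨by linarith [hp'.1], by linarith [hp'.2]⟩)
      (fun x hx => ⟨by linarith [hx.1], by linarith [hx.2]⟩)
      (fun p _ => by ring) (fun x _ => by ring) ?_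
    have key := rpow_inv_diffeomorphism_of_deriv_eq (b := q1 - p1) (sub_pos.2 hpq1) hρ1 N
      (ψ := fun x => ψ (p1 + x)) (h := fun x => (p2 - (p1 + x)) ^ (ρ2 - 1) * ψt (p1 + x))
      (φ := φ1 ∘ fun x => p1 + x) ?_ ?_ ?_ ?_
    · simpa using key
    · refine ContDiffOn.mul (ContDiffOn.rpow_const_of_ne (by fun_prop) fun x hx => ?_)
        (hψtC.comp (by fun_prop) hmaps)
      have := hx.2
      exact (by linarith : 0 < p2 - (p1 + x)).ne'
    · intro x hx
      exact mul_pos (Real.rpow_pos_of_pos (by linarith [hx.2]) _) (hψtpos _ (hmaps hx))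
    · intro x hx
      have := (hψ _ (hmaps hx)).comp x ((hasDerivWithinAt_id x _).const_add p1) hmaps
      exact this.congr_deriv (by rw [add_sub_cancel_left]; ring)
    · intro x hx
      simpa using hφ1 (p1 + x) ⟨by linarith [hx.1], by linarith [hx.2]⟩
  · have hmaps : MapsTo (fun x => p2 - x) (Icc 0 (p2 - q2)) (Icc p1 p2) := fun x hx =>
      ⟨by linarith [hx.2], by linarith [hx.1]⟩
    refine diffeomorphism_of_comp (u := fun p => p2 - p) (v := fun x => p2 - x)
      (T := Icc 0 (p2 - q2)) (by fun_prop) (by fun_prop)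
      (fun p hp' => ⟨by linarith [hp'.2], by linarith [hp'.1]⟩)
      (fun x hx => ⟨by linarith [hx.2], by linarith [hx.1]⟩)
      (fun p _ => by ring) (fun x _ => by ring) ?_
    have key := rpow_inv_diffeomorphism_of_deriv_eq (b := p2 - q2) (sub_pos.2 hqp2) hρ2 N
      (ψ := fun x => -ψ (p2 - x)) (h := fun x => (p2 - x - p1) ^ (ρ1 - 1) * ψt (p2 - x))
      (φ := φ2 ∘ fun x => p2 - x) ?_ ?_ ?_ ?_
    · simpa using key
    · refine ContDiffOn.mul (ContDiffOn.rpow_const_of_ne (by fun_prop) fun x hx => ?_)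
        (hψtC.comp (by fun_prop) hmaps)
      have := hx.2
      exact (by linarith : 0 < p2 - x - p1).ne'
    · intro x hx
      exact mul_pos (Real.rpow_pos_of_pos (by linarith [hx.2]) _) (hψtpos _ (hmaps hx))
    · intro x hx
      have := ((hψ _ (hmaps hx)).comp x ((hasDerivWithinAt_id x _).const_sub p2) hmaps).neg
      exact this.congr_deriv (by rw [sub_sub_cancel]; ring)
    · intro x hx
      have := hφ2 (p2 - x) ⟨by linarith [hx.2], by linarith [hx.1]⟩
      simpa [sub_eq_add_neg, add_comm] using this
end

section
/- Let j ∈ {1,2}, ρ_j ≥ 1, ω > 0 and s ≥ 0. Then for all t ≥ 0: |exp( (−1)^{j+1} i ω ( s + t e^{(−1)^{j+1} iπ/(2ρ_j)} )^{ρ_j} )| ≤ e^{−ω t^{ρ_j}}. -/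
open MeasureTheory Set

/-- Shifting a point of the ray of angle `α` to the right does not increase its argument beyond
`α`. -/
theorem arg_add_mul_exp_mem_Icc {s t α : ℝ} (hs : 0 ≤ s) (ht : 0 ≤ t) (hα : 0 < α)
    (hα' : α ≤ Real.pi / 2) :
    ((s : ℂ) + t * Complex.exp (Complex.I * (α : ℂ))).arg ∈ Set.Icc 0 α := by
  have hexp : Complex.exp (Complex.I * (α : ℂ)) = (Real.cos α : ℂ) + Real.sin α * Complex.I := by
    rw [mul_comm, Complex.exp_mul_I, Complex.ofReal_cos, Complex.ofReal_sin]
  set z : ℂ := (s : ℂ) + t * Complex.exp (Complex.I * (α : ℂ)) with hz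
  have hre : z.re = s + t * Real.cos α := by
    simp [hz, hexp, -Complex.ofReal_cos, -Complex.ofReal_sin]
  have him : z.im = t * Real.sin α := by
    simp [hz, hexp, -Complex.ofReal_cos, -Complex.ofReal_sin]
  have hsin : 0 < Real.sin α := Real.sin_pos_of_pos_of_lt_pi hα (by linarith [Real.pi_pos])
  have h0 : 0 ≤ z.arg := Complex.arg_nonneg_iff.2 (by rw [him]; positivity)
  refine ⟨h0, ?_⟩
  by_contra! hlt
  have hne : z ≠ 0 := by
    intro h
    rw [h, Complex.arg_zero] at hlt
    linarith
  have hpos : 0 < Real.sin (z.arg - α) :=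
    Real.sin_pos_of_pos_of_lt_pi (by linarith) (by linarith [Complex.arg_le_pi z])
  have hmul : ‖z‖ * Real.sin (z.arg - α) = -(s * Real.sin α) := by
    rw [Real.sin_sub, mul_sub, ← mul_assoc, ← mul_assoc, Complex.norm_mul_sin_arg,
      Complex.norm_mul_cos_arg, hre, him]
    ring
  have : 0 < ‖z‖ * Real.sin (z.arg - α) := mul_pos (norm_pos_iff.2 hne) hpos
  nlinarith [mul_nonneg hs hsin.le]

/-- A real power has nonnegative imaginary part where `r` times the argument lies in `[0, π]`. -/
theorem im_cpow_ofReal_nonneg {z : ℂ} {r : ℝ} (h0 : 0 ≤ z.arg * r) (h1 : z.arg * r ≤ Real.pi) :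
    0 ≤ (z ^ (r : ℂ)).im := by
  rw [Complex.cpow_ofReal_im]
  exact mul_nonneg (Real.rpow_nonneg (norm_nonneg _) _) (Real.sin_nonneg_of_nonneg_of_le_pi h0 h1)

theorem rpow_le_im_add_mul_exp_cpow {ρ s t : ℝ} (hρ : 1 ≤ ρ) (hs : 0 ≤ s) (ht : 0 ≤ t) :
    t ^ ρ ≤ (((s : ℂ) + t * Complex.exp (Complex.I * ((Real.pi / (2 * ρ) : ℝ) : ℂ))) ^
      (ρ : ℂ)).im := by
  have hρ0 : 0 < ρ := by linarith
  set α : ℝ := Real.pi / (2 * ρ) with hα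
  have hα0 : 0 < α := by positivity
  have hαρ : α * ρ = Real.pi / 2 := by rw [hα]; field_simp
  have hα1 : α ≤ Real.pi / 2 := by nlinarith
  rcases ht.eq_or_lt with rfl | ht0
  · rw [Real.zero_rpow hρ0.ne']
    refine im_cpow_ofReal_nonneg ?_ ?_ <;> simp [Complex.arg_ofReal_of_nonneg hs, Real.pi_pos.le]
  set e : ℂ := Complex.exp (Complex.I * (α : ℂ)) with he
  have heim : e.im = Real.sin α := by
    rw [he, mul_comm, Complex.exp_ofReal_mul_I_im]
  have hsin : 0 < Real.sin α := Real.sin_pos_of_pos_of_lt_pi hα0 (by linarith [Real.pi_pos])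
  have hslit (x : ℝ) : (x : ℂ) + t * e ∈ Complex.slitPlane := by
    refine Or.inr ?_
    simp [heim, ht0.ne', hsin.ne']
  have hderiv (x : ℝ) : HasDerivAt (fun y : ℝ => (((y : ℂ) + t * e) ^ (ρ : ℂ)).im)
      ((ρ : ℂ) * ((x : ℂ) + t * e) ^ ((ρ : ℂ) - 1) * 1).im x := by
    have h1 : HasDerivAt (fun w : ℂ => (w + t * e) ^ (ρ : ℂ))
        ((ρ : ℂ) * ((x : ℂ) + t * e) ^ ((ρ : ℂ) - 1) * 1) (x : ℂ) :=
      ((hasDerivAt_id _).add_const _).cpow_const (hslit x)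
    exact Complex.imCLM.hasFDerivAt.comp_hasDerivAt x h1.comp_ofReal
  have hmono : MonotoneOn (fun y : ℝ => (((y : ℂ) + t * e) ^ (ρ : ℂ)).im) (Set.Ici 0) := by
    refine monotoneOn_of_deriv_nonneg (convex_Ici 0)
      (fun x _ => (hderiv x).continuousAt.continuousWithinAt)
      (fun x _ => (hderiv x).differentiableAt.differentiableWithinAt) fun x hx => ?_
    rw [interior_Ici] at hx
    obtain ⟨h0, h1⟩ := arg_add_mul_exp_mem_Icc (le_of_lt hx) ht hα0 hα1
    rw [(hderiv x).deriv, mul_one, Complex.im_ofReal_mul, ← Complex.ofReal_one,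
      ← Complex.ofReal_sub]
    refine mul_nonneg hρ0.le (im_cpow_ofReal_nonneg ?_ ?_)
    · exact mul_nonneg h0 (by linarith)
    · calc _ ≤ α * (ρ - 1) := mul_le_mul_of_nonneg_right h1 (by linarith)
        _ ≤ Real.pi := by nlinarith [Real.pi_pos]
  refine le_trans (le_of_eq ?_) (hmono Set.self_mem_Ici hs hs)
  have harg : ((t : ℂ) * e).arg = α := by
    rw [Complex.arg_real_mul _ ht0, he, mul_comm, Complex.arg_exp_mul_I, toIocMod_eq_self]
    constructor <;> linarith [Real.pi_pos]
  have hnorm : ‖(t : ℂ) * e‖ = t := by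
    rw [norm_mul, he, Complex.norm_exp_I_mul_ofReal, mul_one, Complex.norm_real,
      Real.norm_of_nonneg ht]
  simp only [Complex.ofReal_zero, zero_add]
  rw [Complex.cpow_ofReal_im, harg, hnorm, hαρ, Real.sin_pi_div_two, mul_one]

/-- Lemma 5.3 (oscillation control on the shifted ray): for `j ∈ {1,2}` (encoded by the
sign `σ = (−1)^{j+1} ∈ {1,−1}`), `ρ_j ≥ 1`, `ω > 0` and `s ≥ 0`, one has
`|exp((−1)^{j+1} i ω (s + t e^{(−1)^{j+1} iπ/(2ρ_j)})^{ρ_j})| ≤ e^{−ω t^{ρ_j}}` for all `t ≥ 0`.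
Complex powers are principal branches. -/
theorem stmt18 (σ ρ ω s : ℝ) (hσ : σ = 1 ∨ σ = -1) (hρ : 1 ≤ ρ) (hω : 0 < ω) (hs : 0 ≤ s) :
    ∀ t : ℝ, 0 ≤ t →
      ‖Complex.exp ((σ : ℂ) * Complex.I * (ω : ℂ) *
          (((s : ℂ) + (t : ℂ) * Complex.exp (Complex.I * ((σ * Real.pi / (2 * ρ) : ℝ) : ℂ)))
            ^ ((ρ : ℝ) : ℂ)))‖
        ≤ Real.exp (-ω * t ^ ρ) := by
  intro t ht
  have key := rpow_le_im_add_mul_exp_cpow hρ hs ht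
  rw [Complex.norm_exp, Real.exp_le_exp]
  rcases hσ with rfl | rfl
  · simp only [Complex.ofReal_one, one_mul, mul_assoc, Complex.I_mul_re, Complex.im_ofReal_mul]
    nlinarith
  · have hρ0 : 0 < ρ := by linarith
    have harg := arg_add_mul_exp_mem_Icc (α := Real.pi / (2 * ρ)) hs ht (by positivity)
      (div_le_div_of_nonneg_left Real.pi_pos.le (by norm_num) (by linarith))
    set z : ℂ := (s : ℂ) + t * Complex.exp (Complex.I * ((Real.pi / (2 * ρ) : ℝ) : ℂ)) with hz
    have hconj : (s : ℂ) + t * Complex.exp (Complex.I * ((-1 * Real.pi / (2 * ρ) : ℝ) : ℂ)) =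
        (starRingEnd ℂ) z := by
      rw [hz, map_add, map_mul, Complex.conj_ofReal, Complex.conj_ofReal, ← Complex.exp_conj,
        map_mul, Complex.conj_I, Complex.conj_ofReal, neg_one_mul, neg_div, Complex.ofReal_neg,
        neg_mul, mul_neg]
    have hne : z.arg ≠ Real.pi := by
      have : Real.pi / (2 * ρ) < Real.pi := div_lt_self Real.pi_pos (by linarith)
      exact (harg.2.trans_lt this).ne
    rw [hconj, Complex.conj_cpow _ _ hne, Complex.conj_ofReal]
    simp only [Complex.ofReal_neg, Complex.ofReal_one, neg_mul, one_mul, mul_assoc, Complex.neg_re,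
      Complex.I_mul_re, Complex.im_ofReal_mul, Complex.conj_im]
    nlinarith
end
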